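/- Let p* , q ∈ [2,∞] and α1, α2, α3, β1, β2, β3 ≥ 1. Suppose that for all positive integers m, n and every real m×n matrix A = (a_{ij}) both bounds hold: (i) E‖G_A‖_{p→q} ≤ α1·D1 + α2·D2 + α3·√(Log(mn))·max_{i,j}|a_{ij}|, and (ii) E‖G_A‖_{p→q} ≤ β1·D1 + β2·D2 + β3·max_{i,j} (i+j)^{1/(8(p* ∨ q))} |a_{ij}|. Then there is a universal constant C > 0 such that for all m, n and all A: E‖G_A‖_{p→q} ≤ C·[ (α1 + β1 + β3)·D1 + (α2 + β2 + β3)·D2 + α3·max_{k ≥ 0} inf_{I ⊂ [m]×[n], |I| = k} √(Log k)·max_{(i,j) ∉ I} |a_{ij}| ]. -/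

import Mathlib

open MeasureTheory ProbabilityTheory
open scoped ENNReal NNReal

noncomputable section

/-- The `ℓ_r` norm of a finite real vector, `r ∈ [1,∞]`. -/
def lpNorm (r : ℝ≥0∞) {ι : Type*} [Fintype ι] (x : ι → ℝ) : ℝ :=
  if r = ⊤ then ⨆ i, |x i| else (∑ i, |x i| ^ r.toReal) ^ (1 / r.toReal)

/-- The operator norm `‖M‖_{p→q}` expressed via the conjugate exponent `q*`:
the supremum of the bilinear form over `s` in the unit ball of `ℓ_{q*}` and
`t` in the unit ball of `ℓ_p`. -/
def opNorm (p qstar : ℝ≥0∞) {ι κ : Type*} [Fintype ι] [Fintype κ]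
    (M : ι → κ → ℝ) : ℝ :=
  sSup { x : ℝ | ∃ s : ι → ℝ, ∃ t : κ → ℝ,
    lpNorm qstar s ≤ 1 ∧ lpNorm p t ≤ 1 ∧ x = ∑ i, ∑ j, M i j * s i * t j }

/-- The standard Gaussian product measure on `ι → ℝ` (iid `N(0,1)` coordinates). -/
def stdGaussian (ι : Type*) [Fintype ι] : Measure (ι → ℝ) :=
  Measure.pi fun _ => gaussianReal 0 1

/-- `Log x = max 1 (ln x)`; in particular `Log 0 = 1`. -/
def Log (x : ℝ) : ℝ := max 1 (Real.log x)

/-- `E‖G_A‖_{p→q}` for the Gaussian matrix `G_A = (a_{ij} g_{ij})`. -/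
def EopNorm (p qstar : ℝ≥0∞) {m n : ℕ} (A : Fin m → Fin n → ℝ) : ℝ :=
  ∫ g : Fin m × Fin n → ℝ,
    opNorm p qstar (fun i j => A i j * g (i, j)) ∂ stdGaussian (Fin m × Fin n)

/-- `D1 = max_i ‖(a_{ij})_j‖_{p*}`. -/
def D1 (pstar : ℝ≥0∞) {m n : ℕ} (A : Fin m → Fin n → ℝ) : ℝ :=
  ⨆ i, lpNorm pstar (fun j => A i j)

/-- `D2 = max_j ‖(a_{ij})_i‖_q`. -/
def D2 (q : ℝ≥0∞) {m n : ℕ} (A : Fin m → Fin n → ℝ) : ℝ :=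
  ⨆ j, lpNorm q (fun i => A i j)

/-- `max_{i,j} |a_{ij}|`. -/
def maxEntry {m n : ℕ} (A : Fin m → Fin n → ℝ) : ℝ :=
  ⨆ ij : Fin m × Fin n, |A ij.1 ij.2|

/-- `max_{k ≥ 0} inf_{I ⊂ [m]×[n], |I| = k} √(Log k) · max_{(i,j) ∉ I} |a_{ij}|`
(for `k > mn` the term vanishes, so `k` ranges over `0,…,mn`). -/
def Dinf {m n : ℕ} (A : Fin m → Fin n → ℝ) : ℝ :=
  ⨆ k : Fin (m * n + 1),
    ⨅ I : { I : Finset (Fin m × Fin n) // I.card = k.1 },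
      Real.sqrt (Log (k.1 : ℝ)) *
        ⨆ ij : { ij : Fin m × Fin n // ij ∉ I.1 }, |A ij.1.1 ij.1.2|

/-- `E max_{i,j} |a_{ij} g_{ij}|`. -/
def EmaxGauss {m n : ℕ} (A : Fin m → Fin n → ℝ) : ℝ :=
  ∫ g : Fin m × Fin n → ℝ,
    (⨆ ij : Fin m × Fin n, |A ij.1 ij.2 * g ij|) ∂ stdGaussian (Fin m × Fin n)
/-! ### The bilinear form and the operator norm -/

/-- The exponent `r` is finite and lies in `[1, 2]`. -/
def ExponentLow (r : ℝ≥0∞) : Prop := r ≠ ⊤ ∧ 1 ≤ r.toReal ∧ r.toReal ≤ 2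

theorem lpNorm_of_ne_top {r : ℝ≥0∞} (hr : r ≠ ⊤) {ι : Type*} [Fintype ι] (x : ι → ℝ) :
    _root_.lpNorm r x = (∑ i, |x i| ^ r.toReal) ^ (1 / r.toReal) := by
  unfold _root_.lpNorm
  rw [if_neg hr]

theorem sum_rpow_nonneg {ι : Type*} [Fintype ι] (x : ι → ℝ) (r : ℝ) :
    0 ≤ ∑ i, |x i| ^ r :=
  Finset.sum_nonneg fun _ _ => Real.rpow_nonneg (abs_nonneg _) _

theorem lpNorm_nonneg' {r : ℝ≥0∞} (hr : r ≠ ⊤) {ι : Type*} [Fintype ι] (x : ι → ℝ) :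
    0 ≤ _root_.lpNorm r x := by
  rw [lpNorm_of_ne_top hr]
  exact Real.rpow_nonneg (sum_rpow_nonneg _ _) _

theorem lpNorm_rpow {r : ℝ≥0∞} (hr : r ≠ ⊤) (h0 : 0 < r.toReal) {ι : Type*} [Fintype ι]
    (x : ι → ℝ) : _root_.lpNorm r x ^ r.toReal = ∑ i, |x i| ^ r.toReal := by
  rw [lpNorm_of_ne_top hr, ← Real.rpow_mul (sum_rpow_nonneg _ _), one_div,
    inv_mul_cancel₀ h0.ne', Real.rpow_one]

theorem lpNorm_le_iff {r : ℝ≥0∞} (hr : r ≠ ⊤) (h0 : 0 < r.toReal) {ι : Type*} [Fintype ι]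
    (x : ι → ℝ) {c : ℝ} (hc : 0 ≤ c) :
    _root_.lpNorm r x ≤ c ↔ ∑ i, |x i| ^ r.toReal ≤ c ^ r.toReal := by
  rw [← lpNorm_rpow hr h0, Real.rpow_le_rpow_iff (lpNorm_nonneg' hr x) hc h0]

theorem lpNorm_le_one_iff {r : ℝ≥0∞} (hr : r ≠ ⊤) (h0 : 0 < r.toReal) {ι : Type*} [Fintype ι]
    (x : ι → ℝ) : _root_.lpNorm r x ≤ 1 ↔ ∑ i, |x i| ^ r.toReal ≤ 1 := by
  rw [lpNorm_le_iff hr h0 x zero_le_one, Real.one_rpow]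

theorem ExponentLow.pos {r : ℝ≥0∞} (hr : ExponentLow r) : 0 < r.toReal :=
  lt_of_lt_of_le one_pos hr.2.1

theorem abs_le_lpNorm {r : ℝ≥0∞} (hr : r ≠ ⊤) (h0 : 0 < r.toReal) {ι : Type*} [Fintype ι]
    (x : ι → ℝ) (i : ι) : |x i| ≤ _root_.lpNorm r x := by
  rw [← Real.rpow_le_rpow_iff (abs_nonneg _) (lpNorm_nonneg' hr x) h0, lpNorm_rpow hr h0]
  exact Finset.single_le_sum (f := fun i => |x i| ^ r.toReal)
    (fun _ _ => Real.rpow_nonneg (abs_nonneg _) _) (Finset.mem_univ i)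

section OpNorm

variable {p q : ℝ≥0∞} {ι κ : Type*} [Fintype ι] [Fintype κ]

theorem bilin_le_sum_abs (hp : ExponentLow p) (hq : ExponentLow q) (M : ι → κ → ℝ)
    {s : ι → ℝ} {t : κ → ℝ} (hs : _root_.lpNorm q s ≤ 1) (ht : _root_.lpNorm p t ≤ 1) :
    ∑ i, ∑ j, M i j * s i * t j ≤ ∑ i, ∑ j, |M i j| := by
  refine Finset.sum_le_sum fun i _ => Finset.sum_le_sum fun j _ => ?_
  have h1 := (abs_le_lpNorm hq.1 hq.pos s i).trans hs
  have h2 := (abs_le_lpNorm hp.1 hp.pos t j).trans ht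
  calc M i j * s i * t j ≤ |M i j * s i * t j| := le_abs_self _
    _ = |M i j| * (|s i| * |t j|) := by rw [abs_mul, abs_mul, mul_assoc]
    _ ≤ |M i j| * 1 := by
        gcongr
        exact mul_le_one₀ h1 (abs_nonneg _) h2
    _ = _ := mul_one _

theorem bilin_le_opNorm (hp : ExponentLow p) (hq : ExponentLow q) (M : ι → κ → ℝ)
    {s : ι → ℝ} {t : κ → ℝ} (hs : _root_.lpNorm q s ≤ 1) (ht : _root_.lpNorm p t ≤ 1) :
    ∑ i, ∑ j, M i j * s i * t j ≤ opNorm p q M := by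
  refine le_csSup ⟨∑ i, ∑ j, |M i j|, ?_⟩ ⟨s, t, hs, ht, rfl⟩
  rintro _ ⟨s, t, hs, ht, rfl⟩
  exact bilin_le_sum_abs hp hq M hs ht

theorem lpNorm_zero_le {r : ℝ≥0∞} (hr : ExponentLow r) :
    _root_.lpNorm r (fun _ : ι => (0 : ℝ)) ≤ 1 := by
  rw [lpNorm_le_one_iff hr.1 hr.pos]
  simp [Real.zero_rpow hr.pos.ne']

theorem opNorm_le (hp : ExponentLow p) (hq : ExponentLow q) (M : ι → κ → ℝ) {c : ℝ}
    (h : ∀ (s : ι → ℝ) (t : κ → ℝ), _root_.lpNorm q s ≤ 1 → _root_.lpNorm p t ≤ 1 →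
      ∑ i, ∑ j, M i j * s i * t j ≤ c) : opNorm p q M ≤ c := by
  refine csSup_le ⟨_, fun _ => 0, fun _ => 0, lpNorm_zero_le hq, lpNorm_zero_le hp, rfl⟩ ?_
  rintro _ ⟨s, t, hs, ht, rfl⟩
  exact h s t hs ht

theorem opNorm_nonneg (hp : ExponentLow p) (hq : ExponentLow q) (M : ι → κ → ℝ) :
    0 ≤ opNorm p q M := by
  simpa using bilin_le_opNorm hp hq M (s := fun _ => 0) (t := fun _ => 0)
    (lpNorm_zero_le hq) (lpNorm_zero_le hp)

theorem opNorm_add_le (hp : ExponentLow p) (hq : ExponentLow q) (M M' : ι → κ → ℝ) :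
    opNorm p q (fun i j => M i j + M' i j) ≤ opNorm p q M + opNorm p q M' := by
  refine opNorm_le hp hq _ fun s t hs ht => ?_
  have h1 := bilin_le_opNorm hp hq M hs ht
  have h2 := bilin_le_opNorm hp hq M' hs ht
  simp only [add_mul, Finset.sum_add_distrib]
  exact add_le_add h1 h2

theorem opNorm_le_sum_abs (hp : ExponentLow p) (hq : ExponentLow q) (M : ι → κ → ℝ) :
    opNorm p q M ≤ ∑ i, ∑ j, |M i j| :=
  opNorm_le hp hq _ fun _ _ hs ht => bilin_le_sum_abs hp hq M hs ht

theorem opNorm_sub_le (hp : ExponentLow p) (hq : ExponentLow q) (M M' : ι → κ → ℝ) :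
    opNorm p q M - opNorm p q M' ≤ ∑ i, ∑ j, |M i j - M' i j| := by
  have h := opNorm_add_le hp hq (fun i j => M i j - M' i j) M'
  simp only [sub_add_cancel] at h
  have h' := opNorm_le_sum_abs hp hq (fun i j => M i j - M' i j)
  change opNorm p q M ≤ _ at h
  linarith

theorem continuous_opNorm (hp : ExponentLow p) (hq : ExponentLow q) :
    Continuous (fun M : ι → κ → ℝ => opNorm p q M) := by
  refine continuous_iff_continuousAt.2 fun M₀ => ?_
  rw [ContinuousAt, tendsto_iff_dist_tendsto_zero]
  have hc : Continuous fun M : ι → κ → ℝ => ∑ i, ∑ j, |M i j - M₀ i j| := by fun_prop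
  have h0 : Filter.Tendsto (fun M : ι → κ → ℝ => ∑ i, ∑ j, |M i j - M₀ i j|)
      (nhds M₀) (nhds 0) := by
    simpa using hc.tendsto M₀
  refine squeeze_zero (fun _ => dist_nonneg) (fun M => ?_) h0
  rw [Real.dist_eq, abs_le]
  have h1 := opNorm_sub_le hp hq M M₀
  have h2 := opNorm_sub_le hp hq M₀ M
  simp only [abs_sub_comm (M₀ _ _)] at h2
  exact ⟨by linarith, h1⟩

theorem lpNorm_extend {r : ℝ≥0∞} (hr : ExponentLow r) {ι' : Type*} [Fintype ι']
    {e : ι' → ι} (he : Function.Injective e) (s : ι' → ℝ) :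
    _root_.lpNorm r (Function.extend e s 0) = _root_.lpNorm r s := by
  rw [lpNorm_of_ne_top hr.1, lpNorm_of_ne_top hr.1]
  congr 1
  symm
  refine Fintype.sum_of_injective e he _ _ (fun i hi => ?_) fun i => ?_
  · rw [Function.extend_apply' _ _ _ hi]
    simp [Real.zero_rpow hr.pos.ne']
  · rw [he.extend_apply]

theorem opNorm_comp_le (hp : ExponentLow p) (hq : ExponentLow q) {ι' κ' : Type*} [Fintype ι']
    [Fintype κ'] {e : ι' → ι} (he : Function.Injective e) {f : κ' → κ}
    (hf : Function.Injective f) (M : ι → κ → ℝ) :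
    opNorm p q (fun i j => M (e i) (f j)) ≤ opNorm p q M := by
  refine opNorm_le hp hq _ fun s t hs ht => ?_
  have h := bilin_le_opNorm hp hq M (s := Function.extend e s 0) (t := Function.extend f t 0)
    (by rwa [lpNorm_extend hq he]) (by rwa [lpNorm_extend hp hf])
  refine le_of_eq_of_le ?_ h
  refine Fintype.sum_of_injective e he _ _ (fun i hi => ?_) fun i => ?_
  · rw [Function.extend_apply' _ _ _ hi]
    simp
  · refine Fintype.sum_of_injective f hf _ _ (fun j hj => ?_) fun j => ?_
    · rw [Function.extend_apply' _ _ _ hj]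
      simp
    · rw [he.extend_apply, hf.extend_apply]

theorem lpNorm_div_le_one {r : ℝ≥0∞} (hr : ExponentLow r) (s : ι → ℝ)
    (h : 0 < _root_.lpNorm r s) :
    _root_.lpNorm r (fun i => s i / _root_.lpNorm r s) ≤ 1 := by
  rw [lpNorm_le_one_iff hr.1 hr.pos]
  simp_rw [abs_div, Real.div_rpow (abs_nonneg _) (abs_nonneg _), abs_of_pos h,
    ← Finset.sum_div]
  rw [lpNorm_rpow hr.1 hr.pos]
  exact div_self_le_one _

theorem bilin_le_mul (hp : ExponentLow p) (hq : ExponentLow q) (M : ι → κ → ℝ)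
    (s : ι → ℝ) (t : κ → ℝ) :
    ∑ i, ∑ j, M i j * s i * t j ≤
      opNorm p q M * (_root_.lpNorm q s * _root_.lpNorm p t) := by
  have hn := opNorm_nonneg hp hq M
  rcases (lpNorm_nonneg' hq.1 s).eq_or_lt with h | h
  · have : ∀ i, s i = 0 := fun i => by
      have := abs_le_lpNorm hq.1 hq.pos s i
      rw [← h] at this
      exact abs_nonpos_iff.1 this
    simp [this, ← h]
  rcases (lpNorm_nonneg' hp.1 t).eq_or_lt with h' | h'
  · have : ∀ i, t i = 0 := fun i => by
      have := abs_le_lpNorm hp.1 hp.pos t i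
      rw [← h'] at this
      exact abs_nonpos_iff.1 this
    simp [this, ← h']
  have key := bilin_le_opNorm hp hq M (lpNorm_div_le_one hq s h) (lpNorm_div_le_one hp t h')
  rw [← div_le_iff₀ (mul_pos h h')]
  refine le_of_eq_of_le ?_ key
  rw [Finset.sum_div]
  refine Finset.sum_congr rfl fun i _ => ?_
  rw [Finset.sum_div]
  refine Finset.sum_congr rfl fun j _ => ?_
  field_simp

theorem sum_lpNorm_sq_le {r : ℝ≥0∞} (hr : ExponentLow r) (f : ι → ℕ) (L : Finset ℕ)
    (s : ι → ℝ) (hs : _root_.lpNorm r s ≤ 1) :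
    ∑ l ∈ L, _root_.lpNorm r (fun i : {i // f i = l} => s i) ^ 2 ≤ 1 := by
  have hs' := (lpNorm_le_one_iff hr.1 hr.pos s).1 hs
  have hsub : ∀ l, ∑ i : {i // f i = l}, |s i| ^ r.toReal
      = ∑ i with f i = l, |s i| ^ r.toReal := fun l => by
    rw [Finset.sum_subtype (p := fun i => f i = l) _ (by simp)]
  refine le_trans (Finset.sum_le_sum fun l _ => ?_) (le_trans (b :=
    ∑ l ∈ L, ∑ i with f i = l, |s i| ^ r.toReal) le_rfl ?_)
  · have h1 : _root_.lpNorm r (fun i : {i // f i = l} => s i) ≤ 1 := by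
      rw [lpNorm_le_one_iff hr.1 hr.pos, hsub]
      exact (Finset.sum_le_sum_of_subset_of_nonneg (Finset.subset_univ _)
        fun _ _ _ => Real.rpow_nonneg (abs_nonneg _) _).trans hs'
    rw [← hsub, ← lpNorm_rpow hr.1 hr.pos, ← Real.rpow_two]
    exact Real.rpow_le_rpow_of_exponent_ge' (lpNorm_nonneg' hr.1 _) h1 hr.pos.le hr.2.2
  · refine le_trans ?_ hs'
    rw [Finset.sum_fiberwise_eq_sum_filter]
    exact Finset.sum_le_sum_of_subset_of_nonneg (Finset.filter_subset _ _)
        fun _ _ _ => Real.rpow_nonneg (abs_nonneg _) _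

/-- The norm of a block-diagonal matrix is controlled by the norms of its blocks. -/
theorem opNorm_le_of_blocks (hp : ExponentLow p) (hq : ExponentLow q) (M : ι → κ → ℝ)
    (f : ι → ℕ) (h : κ → ℕ) (hM : ∀ i j, f i ≠ h j → M i j = 0) {c : ℝ} (hc : 0 ≤ c)
    (hb : ∀ l ∈ Finset.univ.image f,
      opNorm p q (fun (i : {i // f i = l}) (j : {j // h j = l}) => M i j) ≤ c) :
    opNorm p q M ≤ c := by
  refine opNorm_le hp hq _ fun s t hs ht => ?_
  set L := Finset.univ.image f with hL
  have hsplit : ∑ i, ∑ j, M i j * s i * t j =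
      ∑ l ∈ L, ∑ i : {i // f i = l}, ∑ j : {j // h j = l}, M i j * s i * t j := by
    rw [← Finset.sum_fiberwise_of_maps_to (s := Finset.univ) (t := L) (g := f)
      (fun i _ => Finset.mem_image_of_mem _ (Finset.mem_univ i))]
    refine Finset.sum_congr rfl fun l _ => ?_
    rw [Finset.sum_subtype (p := fun i => f i = l) _ (by simp)]
    refine Finset.sum_congr rfl fun i _ => ?_
    rw [← Finset.sum_subtype (s := Finset.univ.filter fun j => h j = l) (p := fun j => h j = l)
      (by simp) (fun j => M i j * s i * t j), Finset.sum_filter]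
    refine Finset.sum_congr rfl fun j _ => ?_
    split_ifs with hj
    · rfl
    · rw [hM _ _ (by rw [i.2]; exact fun h' => hj h'.symm)]
      simp
  rw [hsplit]
  calc _ ≤ ∑ l ∈ L, c * ((_root_.lpNorm q (fun i : {i // f i = l} => s i) ^ 2
        + _root_.lpNorm p (fun j : {j // h j = l} => t j) ^ 2) / 2) := by
        refine Finset.sum_le_sum fun l hl => ?_
        refine (bilin_le_mul hp hq (fun (i : {i // f i = l}) (j : {j // h j = l}) => M i j)
          (fun i => s i) (fun j => t j)).trans ?_
        refine mul_le_mul (hb l hl) ?_ (mul_nonneg (lpNorm_nonneg' hq.1 _)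
          (lpNorm_nonneg' hp.1 _)) hc
        nlinarith [sq_nonneg (_root_.lpNorm q (fun i : {i // f i = l} => s i)
          - _root_.lpNorm p (fun j : {j // h j = l} => t j))]
    _ = c * ((∑ l ∈ L, _root_.lpNorm q (fun i : {i // f i = l} => s i) ^ 2
        + ∑ l ∈ L, _root_.lpNorm p (fun j : {j // h j = l} => t j) ^ 2) / 2) := by
        rw [← Finset.sum_add_distrib, Finset.sum_div, Finset.mul_sum]
    _ ≤ c * 1 := by
        have h1 := sum_lpNorm_sq_le hq f L s hs
        have h2 := sum_lpNorm_sq_le hp h L t ht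
        gcongr
        linarith
    _ = c := mul_one c

end OpNorm

/-! ### Gaussian product measures -/

instance {ι : Type*} [Fintype ι] : IsProbabilityMeasure (stdGaussian ι) := by
  unfold _root_.stdGaussian
  infer_instance

theorem measurePreserving_stdGaussian_comp {α β : Type*} [Fintype α] [Fintype β] {e : α → β}
    (he : Function.Injective e) :
    MeasurePreserving (fun g : β → ℝ => fun a => g (e a)) (stdGaussian β) (stdGaussian α) := by
  classical
  have hm : Measurable fun g : β → ℝ => fun a => g (e a) := by fun_prop
  refine ⟨hm, ?_⟩
  symm
  refine Measure.pi_eq fun s hs => ?_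
  rw [Measure.map_apply hm (MeasurableSet.univ_pi hs)]
  have : (fun g : β → ℝ => fun a => g (e a)) ⁻¹' Set.univ.pi s
      = Set.univ.pi (Function.extend e s fun _ => Set.univ) := by
    ext g
    simp only [Set.mem_preimage, Set.mem_pi, Set.mem_univ, true_imp_iff]
    refine ⟨fun h b => ?_, fun h a => ?_⟩
    · by_cases hb : ∃ a, e a = b
      · obtain ⟨a, rfl⟩ := hb
        rw [he.extend_apply]
        exact h a
      · rw [Function.extend_apply' _ _ _ hb]
        trivial
    · have := h (e a)
      rwa [he.extend_apply] at this
  rw [this, _root_.stdGaussian, Measure.pi_pi]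
  symm
  refine Fintype.prod_of_injective e he _ _ (fun b hb => ?_) fun a => ?_
  · rw [Function.extend_apply' _ _ _ hb]
    simp
  · rw [he.extend_apply]

theorem measurePreserving_stdGaussian_curry {γ α : Type*} [Fintype γ] [Fintype α] :
    MeasurePreserving (fun g : γ × α → ℝ => fun k a => g (k, a)) (stdGaussian (γ × α))
      (Measure.pi fun _ : γ => stdGaussian α) := by
  have h : MeasurePreserving (MeasurableEquiv.curry γ α ℝ).symm
      (Measure.pi fun _ : γ => stdGaussian α) (stdGaussian (γ × α)) := by
    refine ⟨(MeasurableEquiv.curry γ α ℝ).symm.measurable, ?_⟩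
    symm
    refine Measure.pi_eq fun s hs => ?_
    rw [Measure.map_apply (MeasurableEquiv.curry γ α ℝ).symm.measurable
      (MeasurableSet.univ_pi hs)]
    have : (MeasurableEquiv.curry γ α ℝ).symm ⁻¹' Set.univ.pi s
        = Set.univ.pi fun k => Set.univ.pi fun a => s (k, a) := by
      ext h
      simp only [Set.mem_preimage, Set.mem_pi, Set.mem_univ, true_imp_iff]
      exact ⟨fun H k a => H (k, a), fun H x => H x.1 x.2⟩
    rw [this, Measure.pi_pi]
    simp_rw [_root_.stdGaussian, Measure.pi_pi]
    rw [Fintype.prod_prod_type]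
  exact h.symm

theorem integrable_abs_stdGaussian {ι : Type*} [Fintype ι] (i : ι) :
    Integrable (fun g : ι → ℝ => |g i|) (stdGaussian ι) := by
  have h : Integrable (fun x : ℝ => |x|) (gaussianReal 0 1) :=
    ((memLp_id_gaussianReal 1).integrable (by simp)).abs
  exact (measurePreserving_eval (fun _ : ι => gaussianReal 0 1) i).integrable_comp_of_integrable h

/-- The operator norm of the Gaussian matrix with coefficients `A`, as a random variable. -/
def gaussNorm (p q : ℝ≥0∞) {ι κ : Type*} [Fintype ι] [Fintype κ] (A : ι → κ → ℝ)
    (g : ι × κ → ℝ) : ℝ :=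
  opNorm p q fun i j => A i j * g (i, j)

section GaussNorm

variable {p q : ℝ≥0∞} {ι κ : Type*} [Fintype ι] [Fintype κ]

theorem continuous_gaussNorm (hp : ExponentLow p) (hq : ExponentLow q) (A : ι → κ → ℝ) :
    Continuous (gaussNorm p q A) :=
  (continuous_opNorm hp hq).comp (g := fun M : ι → κ → ℝ => opNorm p q M)
    (f := fun (g : ι × κ → ℝ) i j => A i j * g (i, j)) (by fun_prop)

theorem gaussNorm_nonneg (hp : ExponentLow p) (hq : ExponentLow q) (A : ι → κ → ℝ)
    (g : ι × κ → ℝ) : 0 ≤ gaussNorm p q A g := opNorm_nonneg hp hq _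

theorem integrable_gaussNorm (hp : ExponentLow p) (hq : ExponentLow q) (A : ι → κ → ℝ) :
    Integrable (gaussNorm p q A) (stdGaussian (ι × κ)) := by
  have h : Integrable (fun g : ι × κ → ℝ => ∑ i, ∑ j, |A i j| * |g (i, j)|)
      (stdGaussian (ι × κ)) :=
    integrable_finsetSum _ fun i _ => integrable_finsetSum _ fun j _ =>
      (integrable_abs_stdGaussian (i, j)).const_mul _
  refine h.mono' (continuous_gaussNorm hp hq A).aestronglyMeasurable
    (Filter.Eventually.of_forall fun g => ?_)
  rw [Real.norm_of_nonneg (gaussNorm_nonneg hp hq A g)]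
  refine (opNorm_le_sum_abs hp hq _).trans (le_of_eq ?_)
  simp_rw [abs_mul]

theorem integral_gaussNorm_add_le (hp : ExponentLow p) (hq : ExponentLow q)
    (A B : ι → κ → ℝ) :
    ∫ g, gaussNorm p q (fun i j => A i j + B i j) g ∂stdGaussian (ι × κ) ≤
      ∫ g, gaussNorm p q A g ∂stdGaussian (ι × κ)
        + ∫ g, gaussNorm p q B g ∂stdGaussian (ι × κ) := by
  rw [← integral_add (integrable_gaussNorm hp hq A) (integrable_gaussNorm hp hq B)]
  refine integral_mono (integrable_gaussNorm hp hq _)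
    ((integrable_gaussNorm hp hq A).add (integrable_gaussNorm hp hq B)) fun g => ?_
  refine le_of_eq_of_le ?_ (opNorm_add_le hp hq _ _)
  simp only [gaussNorm, add_mul]

theorem integral_gaussNorm_comp_le (hp : ExponentLow p) (hq : ExponentLow q)
    {ι' κ' : Type*} [Fintype ι'] [Fintype κ'] {e : ι' → ι} (he : Function.Injective e)
    {f : κ' → κ} (hf : Function.Injective f) (A : ι → κ → ℝ) :
    ∫ g, gaussNorm p q (fun i j => A (e i) (f j)) g ∂stdGaussian (ι' × κ') ≤
      ∫ g, gaussNorm p q A g ∂stdGaussian (ι × κ) := by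
  have hmp := measurePreserving_stdGaussian_comp (he.prodMap hf)
  rw [← hmp.map_eq, integral_map hmp.measurable.aemeasurable
    (continuous_gaussNorm hp hq _).aestronglyMeasurable]
  refine integral_mono (hmp.integrable_comp_of_integrable (integrable_gaussNorm hp hq _))
    (integrable_gaussNorm hp hq A) fun g => ?_
  exact opNorm_comp_le hp hq he hf fun i j => A i j * g (i, j)

end GaussNorm

/-! ### Excess of one variable, given a bound for the maximum of independent copies -/

theorem integral_excess_le_of_copies {Ω : Type*} [MeasurableSpace Ω] (ν : Measure Ω)
    [IsProbabilityMeasure ν] {N : ℕ} (hN : 0 < N) {X : Ω → ℝ} (hX : Measurable X)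
    (hX0 : ∀ ω, 0 ≤ X ω) (hXi : Integrable X ν) {F : (Fin N → Ω) → ℝ}
    (hF : Integrable F (Measure.pi fun _ => ν)) (hXF : ∀ ω k, X (ω k) ≤ F ω) {K : ℝ}
    (hK : 0 < K) (hFK : ∫ ω, F ω ∂(Measure.pi fun _ => ν) ≤ K) :
    ∫ x, {x | 2 * K < X x}.indicator X x ∂ν ≤ 2 * K / N := by
  classical
  have : Nonempty (Fin N) := ⟨⟨0, hN⟩⟩
  have hF0 : ∀ ω, 0 ≤ F ω := fun ω => (hX0 _).trans (hXF ω ⟨0, hN⟩)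
  have hms : MeasurableSet {x | 2 * K < X x} := measurableSet_lt measurable_const hX
  have hms' : MeasurableSet {x | X x ≤ 2 * K} := measurableSet_le hX measurable_const
  set Y := {x | 2 * K < X x}.indicator X with hY
  set Z := {x | X x ≤ 2 * K}.indicator (fun _ => (1 : ℝ)) with hZ
  have hYi : Integrable Y ν := hXi.indicator hms
  have hZi : Integrable Z ν := (integrable_const 1).indicator hms'
  have hY0 : 0 ≤ ∫ x, Y x ∂ν := integral_nonneg fun x => Set.indicator_nonneg (fun y _ => hX0 y) x
  set P := ν.real {x | X x ≤ 2 * K} with hP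
  have hZP : ∫ x, Z x ∂ν = P := by
    rw [hZ, integral_indicator_const _ hms']
    simp [hP]
  have hP0 : 0 ≤ P := measureReal_nonneg
  have hP1 : P ≤ 1 := measureReal_le_one
  have hmarkov := mul_meas_ge_le_integral_of_nonneg (μ := Measure.pi fun _ : Fin N => ν)
    (Filter.Eventually.of_forall hF0) hF (2 * K)
  have hpow : (1 / 2 : ℝ) ≤ P ^ N := by
    have h1 : (Measure.pi fun _ : Fin N => ν).real (Set.univ.pi fun _ => {x | X x ≤ 2 * K})
        = P ^ N := by
      simp [measureReal_def, Measure.pi_pi, hP]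
    have h2 : (Set.univ.pi fun _ : Fin N => {x | X x ≤ 2 * K})ᶜ ⊆ {ω | 2 * K ≤ F ω} := by
      intro ω hω
      simp only [Set.mem_compl_iff, Set.mem_pi, Set.mem_univ, true_imp_iff, Set.mem_ofPred_eq,
        not_forall, not_le] at hω
      obtain ⟨k, hk⟩ := hω
      exact hk.le.trans (hXF ω k)
    have h3 := measureReal_mono (μ := Measure.pi fun _ : Fin N => ν) h2
    rw [probReal_compl_eq_one_sub (MeasurableSet.univ_pi fun _ => hms'), h1] at h3
    nlinarith
  have hpow' : (1 / 2 : ℝ) ≤ P ^ (N - 1) :=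
    hpow.trans (pow_le_pow_of_le_one hP0 hP1 (Nat.sub_le _ _))
  have hprodint : ∀ k : Fin N, Integrable
      (fun ω : Fin N → Ω => ∏ j, (if j = k then Y else Z) (ω j)) (Measure.pi fun _ => ν) :=
    fun k => Integrable.fintype_prod (f := fun j => if j = k then Y else Z) fun j => by
      split_ifs <;> assumption
  have hprod : ∀ k : Fin N, ∫ ω : Fin N → Ω, ∏ j, (if j = k then Y else Z) (ω j)
      ∂(Measure.pi fun _ => ν) = (∫ x, Y x ∂ν) * P ^ (N - 1) := by
    intro k
    rw [integral_fintype_prod_eq_prod (fun j => if j = k then Y else Z),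
      ← Finset.mul_prod_erase _ _ (Finset.mem_univ k), if_pos rfl]
    congr 1
    rw [Finset.prod_congr rfl (g := fun _ => P), Finset.prod_const,
      Finset.card_erase_of_mem (Finset.mem_univ k), Finset.card_univ, Fintype.card_fin]
    intro j hj
    rw [if_neg (Finset.ne_of_mem_erase hj), hZP]
  have hYnn : ∀ x, 0 ≤ Y x := fun x => Set.indicator_nonneg (fun y _ => hX0 y) x
  have hpt : ∀ ω : Fin N → Ω, ∑ k, ∏ j, (if j = k then Y else Z) (ω j) ≤ F ω := by
    intro ω
    by_cases hex : ∃ k, ∏ j, (if j = k then Y else Z) (ω j) ≠ 0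
    · obtain ⟨k, hk⟩ := hex
      have hkY : Y (ω k) ≠ 0 := fun h => hk (Finset.prod_eq_zero (Finset.mem_univ k) (by simp [h]))
      have hkbig : 2 * K < X (ω k) := by
        by_contra hcon
        exact hkY (Set.indicator_of_notMem (s := {x | 2 * K < X x}) hcon X)
      have hoth : ∀ k' ≠ k, ∏ j, (if j = k' then Y else Z) (ω j) = 0 := by
        intro k' hk'
        refine Finset.prod_eq_zero (Finset.mem_univ k) ?_
        rw [if_neg hk'.symm]
        exact Set.indicator_of_notMem (s := {x | X x ≤ 2 * K}) (not_le.2 hkbig) _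
      rw [Finset.sum_eq_single k (fun k' _ hk' => hoth k' hk') (by simp)]
      refine le_trans ?_ (hXF ω k)
      rw [← Finset.mul_prod_erase _ _ (Finset.mem_univ k), if_pos rfl]
      have hY' : Y (ω k) ≤ X (ω k) := Set.indicator_le_self' (fun x _ => hX0 x) _
      have hle : ∏ j ∈ Finset.univ.erase k, (if j = k then Y else Z) (ω j) ≤ 1 := by
        refine Finset.prod_le_one (fun j hj => ?_) fun j hj => ?_ <;>
          rw [if_neg (Finset.ne_of_mem_erase hj)]
        · exact Set.indicator_nonneg (fun _ _ => zero_le_one) _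
        · exact Set.indicator_le_self' (fun _ _ => zero_le_one) _
      exact (mul_le_of_le_one_right (hYnn _) hle).trans hY'
    · push Not at hex
      simp only [hex, Finset.sum_const_zero]
      exact hF0 ω
  have hint := integral_mono (integrable_finsetSum Finset.univ fun k _ => hprodint k) hF hpt
  rw [integral_finsetSum _ fun k _ => hprodint k] at hint
  simp only [hprod, Finset.sum_const, Finset.card_univ, Fintype.card_fin, nsmul_eq_mul] at hint
  have hN' : (0 : ℝ) < N := Nat.cast_pos.2 hN
  rw [le_div_iff₀ hN']
  nlinarith [mul_le_mul_of_nonneg_left hpow' (mul_nonneg hN'.le hY0)]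

/-! ### Block-diagonal Gaussian matrices -/

theorem lpNorm_comp_le {r : ℝ≥0∞} (hr : r ≠ ⊤) (h0 : 0 < r.toReal) {ι ι' : Type*} [Fintype ι]
    [Fintype ι'] {e : ι' → ι} (he : Function.Injective e) (x : ι → ℝ) :
    _root_.lpNorm r (fun i => x (e i)) ≤ _root_.lpNorm r x := by
  classical
  rw [lpNorm_le_iff hr h0 _ (lpNorm_nonneg' hr x), lpNorm_rpow hr h0,
    ← Finset.sum_image (s := Finset.univ) (g := e) (f := fun i => |x i| ^ r.toReal)
      (fun a _ b _ h => he h)]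
  exact Finset.sum_le_sum_of_subset_of_nonneg (Finset.subset_univ _)
    fun _ _ _ => Real.rpow_nonneg (abs_nonneg _) _

theorem lpNorm_ite_prod_le {r : ℝ≥0∞} (hr : r ≠ ⊤) (h0 : 0 < r.toReal) {γ ι : Type*} [Fintype ι]
    [Fintype γ] [DecidableEq γ] (k : γ) (x : ι → ℝ) :
    _root_.lpNorm r (fun y : γ × ι => if k = y.1 then x y.2 else 0) ≤ _root_.lpNorm r x := by
  rw [lpNorm_le_iff hr h0 _ (lpNorm_nonneg' hr x), lpNorm_rpow hr h0, Fintype.sum_prod_type,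
    Finset.sum_eq_single k]
  · simp
  · intro k' _ hk'
    simp [hk'.symm, Real.zero_rpow h0.ne']
  · simp

/-- The first of the two weak estimates, for matrices of every size. -/
def LogEstimate (p pstar q qstar : ℝ≥0∞) (α1 α2 α3 : ℝ) : Prop :=
  ∀ (m n : ℕ), 0 < m → 0 < n → ∀ A : Fin m → Fin n → ℝ,
    EopNorm p qstar A ≤
      α1 * D1 pstar A + α2 * D2 q A +
        α3 * Real.sqrt (Log ((m : ℝ) * (n : ℝ))) * maxEntry A

section Blocks

variable {p pstar q qstar : ℝ≥0∞} {α1 α2 α3 : ℝ} {ι κ : Type*} [Fintype ι] [Fintype κ]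

theorem LogEstimate.integral_gaussNorm_le (H : LogEstimate p pstar q qstar α1 α2 α3)
    (hp : ExponentLow p) (hq : ExponentLow qstar) (hps : pstar ≠ ⊤) (hps0 : 0 < pstar.toReal)
    (hqs : q ≠ ⊤) (hqs0 : 0 < q.toReal) (h1 : 0 ≤ α1) (h2 : 0 ≤ α2) (h3 : 0 ≤ α3)
    [Nonempty ι] [Nonempty κ] (A : ι → κ → ℝ) {d1 d2 M : ℝ}
    (hd1 : ∀ i, _root_.lpNorm pstar (fun j => A i j) ≤ d1)
    (hd2 : ∀ j, _root_.lpNorm q (fun i => A i j) ≤ d2) (hM : ∀ i j, |A i j| ≤ M) :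
    ∫ g, gaussNorm p qstar A g ∂_root_.stdGaussian (ι × κ) ≤ α1 * d1 + α2 * d2 +
      α3 * Real.sqrt (Log ((Fintype.card ι : ℝ) * (Fintype.card κ : ℝ))) * M := by
  have e := (Fintype.equivFin ι).symm
  have f := (Fintype.equivFin κ).symm
  have : Nonempty (Fin (Fintype.card ι)) := e.nonempty
  have : Nonempty (Fin (Fintype.card κ)) := f.nonempty
  set B : Fin (Fintype.card ι) → Fin (Fintype.card κ) → ℝ := fun i j => A (e i) (f j) with hB
  have hle := integral_gaussNorm_comp_le hp hq e.symm.injective f.symm.injective B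
  simp only [hB, Equiv.apply_symm_apply] at hle
  refine hle.trans ((H _ _ Fintype.card_pos Fintype.card_pos B).trans ?_)
  gcongr
  · exact ciSup_le fun i => (lpNorm_comp_le hps hps0 f.injective (A (e i))).trans (hd1 _)
  · exact ciSup_le fun j =>
      (lpNorm_comp_le hqs hqs0 e.injective (fun i => A i (f j))).trans (hd2 _)
  · exact ciSup_le fun x => hM _ _

theorem LogEstimate.integral_excess_le (H : LogEstimate p pstar q qstar α1 α2 α3)
    (hp : ExponentLow p) (hq : ExponentLow qstar) (hps : pstar ≠ ⊤) (hps0 : 0 < pstar.toReal)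
    (hqs : q ≠ ⊤) (hqs0 : 0 < q.toReal) (h1 : 0 ≤ α1) (h2 : 0 ≤ α2) (h3 : 0 ≤ α3)
    [Nonempty ι] [Nonempty κ] (A : ι → κ → ℝ) {d1 d2 M : ℝ}
    (hd1 : ∀ i, _root_.lpNorm pstar (fun j => A i j) ≤ d1)
    (hd2 : ∀ j, _root_.lpNorm q (fun i => A i j) ≤ d2) (hM : ∀ i j, |A i j| ≤ M)
    {N : ℕ} (hN : 0 < N) {K : ℝ} (hK : 0 < K)
    (hle : α1 * d1 + α2 * d2 + α3 * Real.sqrt (Log (((N * Fintype.card ι : ℕ) : ℝ) *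
      ((N * Fintype.card κ : ℕ) : ℝ))) * M ≤ K) :
    ∫ g, {g | 2 * K < gaussNorm p qstar A g}.indicator (gaussNorm p qstar A) g
      ∂_root_.stdGaussian (ι × κ) ≤ 2 * K / N := by
  have : Nonempty (Fin N) := ⟨⟨0, hN⟩⟩
  set A' : Fin N × ι → Fin N × κ → ℝ := fun x y => if x.1 = y.1 then A x.2 y.2 else 0 with hA'
  have hM0 : 0 ≤ M := (abs_nonneg _).trans (hM (Classical.arbitrary ι) (Classical.arbitrary κ))
  have hA'le : ∫ g, gaussNorm p qstar A' g ∂_root_.stdGaussian ((Fin N × ι) × (Fin N × κ)) ≤ K := by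
    refine (H.integral_gaussNorm_le hp hq hps hps0 hqs hqs0 h1 h2 h3 A' (d1 := d1) (d2 := d2)
      (M := M) ?_ ?_ ?_).trans ?_
    · rintro ⟨k, i⟩
      exact (lpNorm_ite_prod_le hps hps0 k (A i)).trans (hd1 i)
    · rintro ⟨k, j⟩
      simp only [hA', eq_comm (b := k)]
      exact (lpNorm_ite_prod_le hqs hqs0 k (fun i => A i j)).trans (hd2 j)
    · rintro ⟨k, i⟩ ⟨k', j⟩
      simp only [hA']
      split_ifs
      · exact hM i j
      · simpa using hM0
    · simpa only [Fintype.card_prod, Fintype.card_fin] using hle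
  have hinj : Function.Injective
      (fun x : Fin N × (ι × κ) => (((x.1, x.2.1), (x.1, x.2.2)) : (Fin N × ι) × (Fin N × κ))) := by
    rintro ⟨k, i, j⟩ ⟨k', i', j'⟩ h
    simp_all
  have hmp := (measurePreserving_stdGaussian_curry (γ := Fin N) (α := ι × κ)).comp
    (measurePreserving_stdGaussian_comp hinj)
  set F : (Fin N → ι × κ → ℝ) → ℝ := fun ω => opNorm p qstar fun (x : Fin N × ι) (y : Fin N × κ) =>
    A' x y * ω x.1 (x.2, y.2) with hF
  have hFc : Continuous F :=
    (continuous_opNorm hp hq).comp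
      (g := fun M : Fin N × ι → Fin N × κ → ℝ => opNorm p qstar M)
      (f := fun (ω : Fin N → ι × κ → ℝ) x y => A' x y * ω x.1 (x.2, y.2)) (by fun_prop)
  have hFg : F ∘ ((fun (g : Fin N × ι × κ → ℝ) k a => g (k, a)) ∘
      fun (g : (Fin N × ι) × (Fin N × κ) → ℝ) (a : Fin N × ι × κ) =>
        g ((a.1, a.2.1), (a.1, a.2.2))) = gaussNorm p qstar A' := by
    funext g
    simp only [hF, Function.comp, gaussNorm]
    congr 1
    funext x y
    simp only [hA']
    obtain ⟨k, i⟩ := x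
    obtain ⟨k', j⟩ := y
    dsimp only
    split_ifs with h
    · rw [h]
    · simp
  refine integral_excess_le_of_copies (_root_.stdGaussian (ι × κ)) hN (F := F)
    (continuous_gaussNorm hp hq A).measurable (gaussNorm_nonneg hp hq A)
    (integrable_gaussNorm hp hq A) ?_ ?_ hK ?_
  · rw [← hmp.integrable_comp hFc.aestronglyMeasurable, hFg]
    exact integrable_gaussNorm hp hq A'
  · intro ω k
    have := opNorm_comp_le hp hq (Prod.mk_right_injective (β := ι) k)
      (Prod.mk_right_injective (β := κ) k)
      (fun (x : Fin N × ι) (y : Fin N × κ) => A' x y * ω x.1 (x.2, y.2))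
    simp only [hA', if_true] at this
    exact this
  · rw [← hmp.map_eq, integral_map hmp.measurable.aemeasurable hFc.aestronglyMeasurable]
    refine le_of_eq_of_le ?_ hA'le
    exact congrArg (fun G => ∫ g, G g ∂_root_.stdGaussian ((Fin N × ι) × (Fin N × κ))) hFg

theorem sqrt_Log_le_of_card {l a b : ℕ} (ha0 : 0 < a) (hb0 : 0 < b) (ha : a ≤ 2 ^ (8 * 2 ^ l))
    (hb : b ≤ 2 ^ (8 * 2 ^ l)) :
    Real.sqrt (Log (((2 ^ l * a : ℕ) : ℝ) * ((2 ^ l * b : ℕ) : ℝ))) ≤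
      5 * Real.sqrt (2 ^ l) := by
  have hl : l ≤ 2 ^ l := Nat.lt_two_pow_self.le
  have hle : 2 ^ l * a * (2 ^ l * b) ≤ 2 ^ (18 * 2 ^ l) := by
    calc 2 ^ l * a * (2 ^ l * b)
        ≤ 2 ^ (2 ^ l) * 2 ^ (8 * 2 ^ l) * (2 ^ (2 ^ l) * 2 ^ (8 * 2 ^ l)) := by
          have := Nat.pow_le_pow_right (n := 2) (by norm_num) hl
          gcongr
      _ = 2 ^ (18 * 2 ^ l) := by
          simp only [← pow_add]
          congr 1
          ring
  have h25 : (5 : ℝ) = Real.sqrt 25 := by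
    rw [show (25 : ℝ) = 5 ^ 2 by norm_num, Real.sqrt_sq (by norm_num)]
  rw [h25, ← Real.sqrt_mul (by norm_num)]
  refine Real.sqrt_le_sqrt ?_
  have h1 : (1 : ℝ) ≤ 2 ^ l := one_le_pow₀ (by norm_num)
  refine max_le (by linarith) ?_
  rw [← Nat.cast_mul]
  calc Real.log ((2 ^ l * a * (2 ^ l * b) : ℕ) : ℝ)
      ≤ Real.log ((2 ^ (18 * 2 ^ l) : ℕ) : ℝ) := by
        refine Real.log_le_log ?_ (by exact_mod_cast hle)
        exact_mod_cast (by positivity : 0 < 2 ^ l * a * (2 ^ l * b))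
    _ = (18 * 2 ^ l) * Real.log 2 := by
        push_cast
        rw [Real.log_pow]
        push_cast
        ring
    _ ≤ 25 * 2 ^ l := by nlinarith [Real.log_two_lt_d9]

theorem sum_one_div_two_pow_le (L : Finset ℕ) : ∑ l ∈ L, (1 / 2 : ℝ) ^ l ≤ 2 := by
  have h := summable_geometric_two.sum_le_tsum L fun _ _ => by positivity
  rwa [tsum_geometric_two] at h

theorem LogEstimate.integral_block_le (H : LogEstimate p pstar q qstar α1 α2 α3)
    (hp : ExponentLow p) (hq : ExponentLow qstar) (hps : pstar ≠ ⊤) (hps0 : 0 < pstar.toReal)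
    (hqs : q ≠ ⊤) (hqs0 : 0 < q.toReal) (h1 : 0 ≤ α1) (h2 : 0 ≤ α2) (h3 : 0 ≤ α3)
    (A : ι → κ → ℝ) {d1 d2 M : ℝ} (hd1_nonneg : 0 ≤ d1) (hd2_nonneg : 0 ≤ d2) (hM_nonneg : 0 ≤ M)
    (hd1 : ∀ i, _root_.lpNorm pstar (fun j => A i j) ≤ d1)
    (hd2 : ∀ j, _root_.lpNorm q (fun i => A i j) ≤ d2)
    (f : ι → ℕ) (h : κ → ℕ) (hf : ∀ l, Fintype.card {i // f i = l} ≤ 2 ^ (8 * 2 ^ l))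
    (hh : ∀ l, Fintype.card {j // h j = l} ≤ 2 ^ (8 * 2 ^ l))
    (hA : ∀ i j, f i ≠ h j → A i j = 0)
    (hM : ∀ i j, f i = h j → |A i j| * Real.sqrt (2 ^ f i) ≤ M) :
    ∫ g, gaussNorm p qstar A g ∂_root_.stdGaussian (ι × κ) ≤
      6 * (α1 * d1 + α2 * d2 + 5 * α3 * M) := by
  set K₀ := α1 * d1 + α2 * d2 + 5 * α3 * M with hK₀
  have hK₀0 : 0 ≤ K₀ := by positivity
  suffices hs : ∀ K > K₀, ∫ g, gaussNorm p qstar A g ∂_root_.stdGaussian (ι × κ) ≤ 6 * K by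
    have : (∫ g, gaussNorm p qstar A g ∂_root_.stdGaussian (ι × κ)) / 6 ≤ K₀ :=
      le_of_forall_gt_imp_ge_of_dense fun K hK => by linarith [hs K hK]
    linarith
  intro K hK
  have hKpos : 0 < K := hK₀0.trans_lt hK
  set B : ∀ l, {i // f i = l} → {j // h j = l} → ℝ := fun l i j => A i j with hB
  set Y : ∀ l, ({i // f i = l} × {j // h j = l} → ℝ) → ℝ := fun l =>
    {g | 2 * K < gaussNorm p qstar (B l) g}.indicator (gaussNorm p qstar (B l)) with hY
  have hYi : ∀ l, Integrable (Y l) (_root_.stdGaussian _) := fun l =>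
    (integrable_gaussNorm hp hq (B l)).indicator
      (measurableSet_lt measurable_const (continuous_gaussNorm hp hq _).measurable)
  have hY0 : ∀ l g, 0 ≤ Y l g := fun l g =>
    Set.indicator_nonneg (fun g _ => gaussNorm_nonneg hp hq _ g) g
  have hYle : ∀ l, ∫ g, Y l g ∂_root_.stdGaussian _ ≤ 2 * K / ((2 ^ l : ℕ) : ℝ) := by
    intro l
    by_cases hne : Nonempty {i // f i = l} ∧ Nonempty {j // h j = l}
    · obtain ⟨hne1, hne2⟩ := hne
      have hs : (0 : ℝ) < Real.sqrt (2 ^ l) := Real.sqrt_pos.2 (by positivity)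
      refine H.integral_excess_le hp hq hps hps0 hqs hqs0 h1 h2 h3 (B l) (d1 := d1) (d2 := d2)
        (M := M / Real.sqrt (2 ^ l)) ?_ ?_ ?_ (by positivity) hKpos ?_
      · intro i
        exact (lpNorm_comp_le hps hps0 Subtype.val_injective (A i)).trans (hd1 i)
      · intro j
        exact (lpNorm_comp_le hqs hqs0 Subtype.val_injective (fun i => A i j)).trans (hd2 j)
      · intro i j
        rw [le_div_iff₀ hs]
        have := hM i j (i.2.trans j.2.symm)
        rwa [i.2] at this
      · refine le_trans ?_ hK.le
        rw [hK₀]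
        have := sqrt_Log_le_of_card Fintype.card_pos Fintype.card_pos (hf l) (hh l)
        calc _ ≤ α1 * d1 + α2 * d2 + α3 * (5 * Real.sqrt (2 ^ l)) * (M / Real.sqrt (2 ^ l)) := by
              gcongr
          _ = _ := by
              field_simp
    · have hz : ∀ g, gaussNorm p qstar (B l) g ≤ 0 := by
        intro g
        refine opNorm_le hp hq _ fun s t _ _ => le_of_eq ?_
        rcases not_and_or.1 hne with hne | hne
        · rw [not_nonempty_iff] at hne
          simp
        · rw [not_nonempty_iff] at hne
          simp
      have : ∀ g, Y l g = 0 := fun g =>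
        Set.indicator_of_notMem (s := {g | 2 * K < gaussNorm p qstar (B l) g})
          (not_lt.2 ((hz g).trans (by positivity))) _
      simp only [this, integral_zero]
      positivity
  set R : ∀ l, (ι × κ → ℝ) → ({i // f i = l} × {j // h j = l} → ℝ) :=
    fun l g x => g (x.1, x.2) with hR
  have hinj : ∀ l, Function.Injective
      (fun x : {i // f i = l} × {j // h j = l} => ((x.1 : ι), (x.2 : κ))) := by
    rintro l ⟨i, j⟩ ⟨i', j'⟩ hx
    simp only [Prod.mk.injEq] at hx
    exact Prod.ext (Subtype.ext hx.1) (Subtype.ext hx.2)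
  have hRmp : ∀ l, MeasurePreserving (R l) (_root_.stdGaussian _) (_root_.stdGaussian _) :=
    fun l => measurePreserving_stdGaussian_comp (hinj l)
  have hYRi : ∀ l, Integrable (fun g => Y l (R l g)) (_root_.stdGaussian (ι × κ)) := fun l =>
    (hRmp l).integrable_comp_of_integrable (hYi l)
  have hYR : ∀ l, ∫ g, Y l (R l g) ∂_root_.stdGaussian (ι × κ) = ∫ g, Y l g ∂_root_.stdGaussian _ := by
    intro l
    rw [← (hRmp l).map_eq, integral_map (hRmp l).measurable.aemeasurable]
    rw [(hRmp l).map_eq]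
    exact (hYi l).aestronglyMeasurable
  set L := Finset.univ.image f with hL
  have hpt : ∀ g, gaussNorm p qstar A g ≤ 2 * K + ∑ l ∈ L, Y l (R l g) := by
    intro g
    have hsum : 0 ≤ ∑ l ∈ L, Y l (R l g) := Finset.sum_nonneg fun l _ => hY0 l _
    refine opNorm_le_of_blocks hp hq _ f h (fun i j hij => by rw [hA i j hij, zero_mul])
      (by positivity) fun l hl => ?_
    change gaussNorm p qstar (B l) (R l g) ≤ _
    rcases le_or_gt (gaussNorm p qstar (B l) (R l g)) (2 * K) with hle | hgt
    · linarith
    · have : Y l (R l g) = gaussNorm p qstar (B l) (R l g) :=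
        Set.indicator_of_mem (s := {g | 2 * K < gaussNorm p qstar (B l) g}) hgt _
      rw [← this]
      have := Finset.single_le_sum (f := fun l => Y l (R l g)) (fun l _ => hY0 l _) hl
      linarith
  have hsumi : Integrable (fun g => ∑ l ∈ L, Y l (R l g)) (_root_.stdGaussian (ι × κ)) :=
    integrable_finsetSum _ fun l _ => hYRi l
  calc ∫ g, gaussNorm p qstar A g ∂_root_.stdGaussian (ι × κ)
      ≤ ∫ g, (2 * K + ∑ l ∈ L, Y l (R l g)) ∂_root_.stdGaussian (ι × κ) :=
        integral_mono (integrable_gaussNorm hp hq A) ((integrable_const _).add hsumi) hpt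
    _ = 2 * K + ∑ l ∈ L, ∫ g, Y l g ∂_root_.stdGaussian _ := by
        rw [integral_add (integrable_const _) hsumi, integral_finsetSum _ fun l _ => hYRi l]
        simp only [hYR, integral_const, probReal_univ, one_smul]
    _ ≤ 2 * K + ∑ l ∈ L, 2 * K * (1 / 2 : ℝ) ^ l := by
        gcongr with l _
        refine (hYle l).trans (le_of_eq ?_)
        push_cast
        rw [one_div, inv_pow, div_eq_mul_inv]
    _ ≤ 6 * K := by
        rw [← Finset.mul_sum]
        nlinarith [sum_one_div_two_pow_le L]

end Blocks

/-! ### Levels of rows and columns -/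

theorem exists_levels {ι κ : Type*} [Fintype ι] [Fintype κ] (U : ℕ → Finset ι)
    (V : ℕ → Finset κ) (R : ℕ → ι → κ → Prop) [∀ l, DecidableRel (R l)]
    (hU : ∀ l, (U l).card ≤ 2 * 2 ^ (12 * 2 ^ l)) (hV : ∀ l, (V l).card ≤ 2 * 2 ^ (12 * 2 ^ l))
    (hUc : ∀ i, ∃ l, i ∈ U l) (hVc : ∀ j, ∃ l, j ∈ V l)
    (hRr : ∀ l i, (Finset.univ.filter fun j => R l i j).card ≤ 2 ^ (4 * 2 ^ l))
    (hRc : ∀ l j, (Finset.univ.filter fun i => R l i j).card ≤ 2 ^ (4 * 2 ^ l)) :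
    ∃ (f : ι → ℕ) (h : κ → ℕ),
      (∀ l, (Finset.univ.filter fun i => f i ≤ l).card ≤ 2 ^ (8 * 2 ^ l)) ∧
      (∀ l, (Finset.univ.filter fun j => h j ≤ l).card ≤ 2 ^ (8 * 2 ^ l)) ∧
      (∀ l i, i ∈ U l → f i ≤ l + 1) ∧ (∀ l j, j ∈ V l → h j ≤ l + 1) ∧
      (∀ l i j, R l i j → h j ≤ l → f i ≤ l + 1) ∧
      (∀ l i j, R l i j → f i ≤ l → h j ≤ l + 1) := by
  classical
  let W : ℕ → Finset ι × Finset κ := fun n => Nat.rec (∅, ∅) (fun l w =>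
    (w.1 ∪ U l ∪ w.2.biUnion fun j => Finset.univ.filter fun i => R l i j,
     w.2 ∪ V l ∪ w.1.biUnion fun i => Finset.univ.filter fun j => R l i j)) n
  have hW0 : W 0 = (∅, ∅) := rfl
  have hW1 : ∀ l, (W (l + 1)).1 =
    (W l).1 ∪ U l ∪ (W l).2.biUnion fun j => Finset.univ.filter fun i => R l i j := fun l => rfl
  have hW2 : ∀ l, (W (l + 1)).2 =
    (W l).2 ∪ V l ∪ (W l).1.biUnion fun i => Finset.univ.filter fun j => R l i j := fun l => rfl
  have hm1 : Monotone fun l => (W l).1 := monotone_nat_of_le_succ fun l => by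
    rw [hW1, Finset.union_assoc]
    exact Finset.subset_union_left
  have hm2 : Monotone fun l => (W l).2 := monotone_nat_of_le_succ fun l => by
    rw [hW2, Finset.union_assoc]
    exact Finset.subset_union_left
  have harith : ∀ l a b : ℕ, a ≤ 2 ^ (8 * 2 ^ l) → b ≤ 2 ^ (8 * 2 ^ l) →
      a + 2 * 2 ^ (12 * 2 ^ l) + b * 2 ^ (4 * 2 ^ l) ≤ 2 ^ (8 * 2 ^ (l + 1)) := by
    intro l a b ha hb
    have h1 : 2 ^ (8 * 2 ^ l) ≤ 2 ^ (12 * 2 ^ l) := Nat.pow_le_pow_right (by norm_num) (by omega)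
    have h2 : b * 2 ^ (4 * 2 ^ l) ≤ 2 ^ (12 * 2 ^ l) := by
      calc b * 2 ^ (4 * 2 ^ l) ≤ 2 ^ (8 * 2 ^ l) * 2 ^ (4 * 2 ^ l) := by gcongr
        _ = 2 ^ (12 * 2 ^ l) := by
          rw [← pow_add]
          congr 1
          ring
    have h3 : 2 ^ 2 * 2 ^ (12 * 2 ^ l) ≤ 2 ^ (8 * 2 ^ (l + 1)) := by
      rw [← pow_add]
      refine Nat.pow_le_pow_right (by norm_num) ?_
      have : 1 ≤ 2 ^ l := Nat.one_le_two_pow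
      rw [pow_succ]
      omega
    omega
  have hcard : ∀ l, (W l).1.card ≤ 2 ^ (8 * 2 ^ l) ∧ (W l).2.card ≤ 2 ^ (8 * 2 ^ l) := by
    intro l
    induction l with
    | zero => simp [hW0]
    | succ l ih =>
      refine ⟨?_, ?_⟩
      · rw [hW1]
        refine le_trans ?_ (harith l _ _ ih.1 ih.2)
        refine (Finset.card_union_le _ _).trans (add_le_add ((Finset.card_union_le _ _).trans
          (add_le_add le_rfl (hU l))) ?_)
        exact Finset.card_biUnion_le_card_mul _ _ _ fun j _ => hRc l j
      · rw [hW2]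
        refine le_trans ?_ (harith l _ _ ih.2 ih.1)
        refine (Finset.card_union_le _ _).trans (add_le_add ((Finset.card_union_le _ _).trans
          (add_le_add le_rfl (hV l))) ?_)
        exact Finset.card_biUnion_le_card_mul _ _ _ fun j _ => hRr l j
  have hU' : ∀ l i, i ∈ U l → i ∈ (W (l + 1)).1 := fun l i hi => by
    rw [hW1]
    exact Finset.mem_union_left _ (Finset.mem_union_right _ hi)
  have hV' : ∀ l j, j ∈ V l → j ∈ (W (l + 1)).2 := fun l j hj => by
    rw [hW2]
    exact Finset.mem_union_left _ (Finset.mem_union_right _ hj)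
  have hex1 : ∀ i, ∃ l, i ∈ (W l).1 := fun i => (hUc i).imp' Nat.succ fun l => hU' l i
  have hex2 : ∀ j, ∃ l, j ∈ (W l).2 := fun j => (hVc j).imp' Nat.succ fun l => hV' l j
  have hf : ∀ i l, Nat.find (hex1 i) ≤ l ↔ i ∈ (W l).1 := fun i l =>
    ⟨fun h => hm1 h (Nat.find_spec (hex1 i)), fun h => Nat.find_min' _ h⟩
  have hh : ∀ j l, Nat.find (hex2 j) ≤ l ↔ j ∈ (W l).2 := fun j l =>
    ⟨fun h => hm2 h (Nat.find_spec (hex2 j)), fun h => Nat.find_min' _ h⟩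
  refine ⟨fun i => Nat.find (hex1 i), fun j => Nat.find (hex2 j), fun l => ?_, fun l => ?_,
    fun l i hi => (hf _ _).2 (hU' l i hi), fun l j hj => (hh _ _).2 (hV' l j hj),
    fun l i j hR hj => ?_, fun l i j hR hi => ?_⟩
  · simp only [hf, Finset.filter_univ_mem]
    exact (hcard l).1
  · simp only [hh, Finset.filter_univ_mem]
    exact (hcard l).2
  · rw [hf, hW1]
    exact Finset.mem_union_right _ (Finset.mem_biUnion.2 ⟨j, (hh _ _).1 hj, by simpa using hR⟩)
  · rw [hh, hW2]
    exact Finset.mem_union_right _ (Finset.mem_biUnion.2 ⟨i, (hf _ _).1 hi, by simpa using hR⟩)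

theorem card_large_entries_le {m n : ℕ} (A : Fin m → Fin n → ℝ) (k : ℕ) :
    (Finset.univ.filter fun x : Fin m × Fin n =>
      Dinf A < |A x.1 x.2| * Real.sqrt (Log (k : ℝ))).card ≤ k := by
  classical
  rcases lt_or_ge (m * n) k with hk | hk
  · exact (Finset.card_le_univ _).trans (by simpa using hk.le)
  have hne : Nonempty {I : Finset (Fin m × Fin n) // I.card = k} := by
    obtain ⟨I, -, hI⟩ := Finset.exists_subset_card_eq (s := (Finset.univ : Finset (Fin m × Fin n)))
      (n := k) (by simpa using hk)
    exact ⟨⟨I, hI⟩⟩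
  obtain ⟨⟨I, hI⟩, hIeq⟩ := exists_eq_ciInf_of_finite
    (f := fun I : {I : Finset (Fin m × Fin n) // I.card = k} => Real.sqrt (Log (k : ℝ)) *
        ⨆ ij : { ij : Fin m × Fin n // ij ∉ I.1 }, |A ij.1.1 ij.1.2|)
  have hle : Real.sqrt (Log (k : ℝ)) * ⨆ ij : { ij : Fin m × Fin n // ij ∉ I }, |A ij.1.1 ij.1.2|
      ≤ Dinf A := by
    refine hIeq.le.trans ?_
    exact le_ciSup (f := fun k : Fin (m * n + 1) =>
      ⨅ I : { I : Finset (Fin m × Fin n) // I.card = k.1 }, Real.sqrt (Log (k.1 : ℝ)) *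
        ⨆ ij : { ij : Fin m × Fin n // ij ∉ I.1 }, |A ij.1.1 ij.1.2|)
      (Set.finite_range _).bddAbove ⟨k, Nat.lt_succ_of_le hk⟩
  calc _ ≤ I.card := by
        refine Finset.card_le_card fun x hx => ?_
        by_contra hxI
        simp only [Finset.mem_filter, Finset.mem_univ, true_and] at hx
        refine absurd hx (not_lt.2 (le_trans ?_ hle))
        rw [mul_comm]
        refine mul_le_mul_of_nonneg_left ?_ (Real.sqrt_nonneg _)
        exact le_ciSup (f := fun ij : { ij : Fin m × Fin n // ij ∉ I } => |A ij.1.1 ij.1.2|)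
          (Set.finite_range _).bddAbove ⟨x, hxI⟩
    _ = k := hI

theorem abs_le_Dinf {m n : ℕ} (A : Fin m → Fin n → ℝ) (i : Fin m) (j : Fin n) :
    |A i j| ≤ Dinf A := by
  have h := card_large_entries_le A 0
  rw [Nat.le_zero, Finset.card_eq_zero, Finset.filter_eq_empty_iff] at h
  simpa [Log] using h (Finset.mem_univ (i, j))

theorem card_large_entries_two_pow_le {m n : ℕ} (A : Fin m → Fin n → ℝ) (l : ℕ) :
    (Finset.univ.filter fun x : Fin m × Fin n =>
      Dinf A < |A x.1 x.2| * Real.sqrt (2 ^ (l + 1))).card ≤ 2 ^ (12 * 2 ^ l) := by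
  refine le_trans (Finset.card_le_card fun x hx => ?_)
    (card_large_entries_le A (2 ^ (12 * 2 ^ l)))
  simp only [Finset.mem_filter, Finset.mem_univ, true_and] at hx ⊢
  refine hx.trans_le (mul_le_mul_of_nonneg_left (Real.sqrt_le_sqrt ?_) (abs_nonneg _))
  refine le_trans ?_ (le_max_right _ _)
  push_cast
  rw [Real.log_pow, pow_succ]
  push_cast
  have : (0 : ℝ) < 2 ^ l := by positivity
  nlinarith [Real.log_two_gt_d9]

theorem card_large_coords_le {κ : Type*} [Fintype κ] {r : ℝ≥0∞} (hr : r ≠ ⊤)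
    (h0 : 0 < r.toReal) {e D : ℝ} (her : e * r.toReal ≤ 1 / 8) (x : κ → ℝ)
    (hx : _root_.lpNorm r x ≤ D) (l : ℕ) :
    (Finset.univ.filter fun j => D < (2 ^ (8 * 2 ^ (l + 2)) : ℝ) ^ e * |x j|).card ≤
      2 ^ (4 * 2 ^ l) := by
  have hD : 0 ≤ D := (lpNorm_nonneg' hr x).trans hx
  set T : ℝ := 2 ^ (8 * 2 ^ (l + 2)) with hT
  have hT1 : 1 ≤ T := one_le_pow₀ (by norm_num)
  set S := Finset.univ.filter fun j => D < T ^ e * |x j| with hS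
  rcases hD.eq_or_lt with h | hDpos
  · have : S = ∅ := by
      rw [hS, Finset.filter_eq_empty_iff]
      intro j _
      have := (abs_le_lpNorm hr h0 x j).trans hx
      rw [← h] at this ⊢
      rw [abs_nonpos_iff.1 this]
      simp
    simp [this]
  have hDP : 0 < D ^ r.toReal := Real.rpow_pos_of_pos hDpos _
  have hsum := (lpNorm_le_iff hr h0 x hD).1 hx
  have h1 : (S.card : ℝ) * D ^ r.toReal ≤ T ^ (1 / 8 : ℝ) * D ^ r.toReal := by
    calc (S.card : ℝ) * D ^ r.toReal = ∑ j ∈ S, D ^ r.toReal := by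
          rw [Finset.sum_const, nsmul_eq_mul]
      _ ≤ ∑ j ∈ S, T ^ (1 / 8 : ℝ) * |x j| ^ r.toReal := by
          refine Finset.sum_le_sum fun j hj => ?_
          have hj' := (Finset.mem_filter.1 hj).2.le
          calc D ^ r.toReal ≤ (T ^ e * |x j|) ^ r.toReal :=
                Real.rpow_le_rpow hD hj' h0.le
            _ = T ^ (e * r.toReal) * |x j| ^ r.toReal := by
                rw [Real.mul_rpow (by positivity) (abs_nonneg _), ← Real.rpow_mul (by positivity)]
            _ ≤ _ := by
                gcongr
      _ = T ^ (1 / 8 : ℝ) * ∑ j ∈ S, |x j| ^ r.toReal := by rw [Finset.mul_sum]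
      _ ≤ _ := by
          gcongr
          exact (Finset.sum_le_sum_of_subset_of_nonneg (Finset.subset_univ _)
            fun _ _ _ => Real.rpow_nonneg (abs_nonneg _) _).trans hsum
  have h2 := le_of_mul_le_mul_right h1 hDP
  have h3 : T ^ (1 / 8 : ℝ) = ((2 ^ (4 * 2 ^ l) : ℕ) : ℝ) := by
    have : T = (2 ^ (4 * 2 ^ l)) ^ 8 := by
      rw [hT, ← pow_mul]
      congr 1
      ring
    rw [this, ← Real.rpow_natCast _ 8, ← Real.rpow_mul (by positivity)]
    norm_num
  rw [h3] at h2
  exact_mod_cast h2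

/-- Rows and columns can be graded so that entries whose levels are close are governed by
`Dinf A`, whereas the remaining entries are small compared with `D`. -/
theorem exists_matrix_levels {m n : ℕ} (A : Fin m → Fin n → ℝ) {pstar q : ℝ≥0∞}
    (hps : pstar ≠ ⊤) (hps0 : 0 < pstar.toReal) (hqs : q ≠ ⊤) (hqs0 : 0 < q.toReal) {e D : ℝ}
    (hep : e * pstar.toReal ≤ 1 / 8) (heq : e * q.toReal ≤ 1 / 8)
    (hd1 : ∀ i, _root_.lpNorm pstar (fun j => A i j) ≤ D)
    (hd2 : ∀ j, _root_.lpNorm q (fun i => A i j) ≤ D) :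
    ∃ (f : Fin m → ℕ) (h : Fin n → ℕ),
      (∀ l, (Finset.univ.filter fun i => f i ≤ l).card ≤ 2 ^ (8 * 2 ^ l)) ∧
      (∀ l, (Finset.univ.filter fun j => h j ≤ l).card ≤ 2 ^ (8 * 2 ^ l)) ∧
      (∀ i j, |A i j| * Real.sqrt (2 ^ f i) ≤ 2 * Dinf A) ∧
      (∀ i j, |A i j| * Real.sqrt (2 ^ h j) ≤ 2 * Dinf A) ∧
      (∀ i j, h j + 2 ≤ f i → (2 ^ (8 * 2 ^ f i) : ℝ) ^ e * |A i j| ≤ D) ∧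
      (∀ i j, f i + 2 ≤ h j → (2 ^ (8 * 2 ^ h j) : ℝ) ^ e * |A i j| ≤ D) := by
  classical
  set E : ℕ → Finset (Fin m × Fin n) := fun l => Finset.univ.filter fun x : Fin m × Fin n =>
      Dinf A < |A x.1 x.2| * Real.sqrt (2 ^ (l + 1)) with hE
  have hEc : ∀ l, (E l).card ≤ 2 ^ (12 * 2 ^ l) := card_large_entries_two_pow_le A
  have hinit : ∀ (k l : ℕ),
      (Finset.univ.filter fun i : Fin k => i.val < 2 ^ (12 * 2 ^ l)).card ≤ 2 ^ (12 * 2 ^ l) := by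
    intro k l
    rw [← Finset.card_map Fin.valEmbedding]
    refine (Finset.card_le_card (t := Finset.range (2 ^ (12 * 2 ^ l))) ?_).trans_eq
      (Finset.card_range _)
    intro x hx
    simp only [Finset.mem_map, Finset.mem_filter, Finset.mem_univ, true_and,
      Fin.valEmbedding_apply] at hx
    obtain ⟨i, hi, rfl⟩ := hx
    exact Finset.mem_range.2 hi
  have hcov : ∀ k : ℕ, k < 2 ^ (12 * 2 ^ k) := fun k =>
    calc k < 2 ^ k := Nat.lt_two_pow_self
      _ < 2 ^ (2 ^ k) := Nat.lt_two_pow_self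
      _ ≤ 2 ^ (12 * 2 ^ k) := Nat.pow_le_pow_right (by norm_num) (by omega)
  obtain ⟨f, h, hf, hh, hfU, hhV, hfR, hhR⟩ := exists_levels
    (fun l => (E l).image Prod.fst ∪ Finset.univ.filter fun i : Fin m => i.val < 2 ^ (12 * 2 ^ l))
    (fun l => (E l).image Prod.snd ∪ Finset.univ.filter fun j : Fin n => j.val < 2 ^ (12 * 2 ^ l))
    (fun l i j => D < (2 ^ (8 * 2 ^ (l + 2)) : ℝ) ^ e * |A i j|)
    (fun l => (Finset.card_union_le _ _).trans (by
      have := (Finset.card_image_le (f := Prod.fst)).trans (hEc l)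
      have := hinit m l
      omega))
    (fun l => (Finset.card_union_le _ _).trans (by
      have := (Finset.card_image_le (f := Prod.snd)).trans (hEc l)
      have := hinit n l
      omega))
    (fun i => ⟨i.val, Finset.mem_union_right _ (by simpa using hcov i)⟩)
    (fun j => ⟨j.val, Finset.mem_union_right _ (by simpa using hcov j)⟩)
    (fun l i => card_large_coords_le hps hps0 hep (A i) (hd1 i) l)
    (fun l j => card_large_coords_le hqs hqs0 heq (fun i => A i j) (hd2 j) l)
  have hDinf : ∀ i j l, (∀ k, (i, j) ∈ E k → l ≤ k + 1) →
      |A i j| * Real.sqrt (2 ^ l) ≤ 2 * Dinf A := by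
    intro i j l hl
    have h0 := abs_le_Dinf A i j
    have hpos := abs_nonneg (A i j)
    have hs2 : Real.sqrt 2 ≤ 2 := Real.sqrt_le_iff.2 ⟨by norm_num, by norm_num⟩
    match l with
    | 0 => simp; linarith
    | 1 => rw [pow_one]; nlinarith
    | l + 2 =>
      have hnot : (i, j) ∉ E l := fun hmem => by
        have := hl l hmem
        omega
      have hle : |A i j| * Real.sqrt (2 ^ (l + 1)) ≤ Dinf A := by simpa [hE] using hnot
      rw [pow_succ (2 : ℝ) (l + 1), Real.sqrt_mul (by positivity), ← mul_assoc]
      nlinarith [mul_nonneg hpos (Real.sqrt_nonneg (2 ^ (l + 1)))]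
  refine ⟨f, h, hf, hh, fun i j => hDinf i j _ fun k hk => hfU k i ?_,
    fun i j => hDinf i j _ fun k hk => hhV k j ?_, fun i j hij => ?_, fun i j hij => ?_⟩
  · exact Finset.mem_union_left _ (Finset.mem_image_of_mem Prod.fst hk)
  · exact Finset.mem_union_left _ (Finset.mem_image_of_mem Prod.snd hk)
  · by_contra hcon
    obtain ⟨l, hl⟩ := Nat.exists_eq_add_of_le' (le_trans (Nat.le_add_left 2 (h j)) hij)
    rw [hl] at hcon
    have := hfR l i j (not_le.1 hcon) (by omega)
    omega
  · by_contra hcon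
    obtain ⟨l, hl⟩ := Nat.exists_eq_add_of_le' (le_trans (Nat.le_add_left 2 (f i)) hij)
    rw [hl] at hcon
    have := hhR l i j (not_le.1 hcon) (by omega)
    omega

/-! ### The far part, via sorting rows and columns by level -/

theorem exists_sorting {m : ℕ} (f : Fin m → ℕ) : ∃ σ : Equiv.Perm (Fin m),
    ∀ a, a.val + 1 ≤ (Finset.univ.filter fun i => f i ≤ f (σ a)).card := by
  refine ⟨Tuple.sort f, fun a => ?_⟩
  rw [← Fin.card_Iic a, ← Finset.card_map (Tuple.sort f).toEmbedding]
  refine Finset.card_le_card fun i hi => ?_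
  obtain ⟨b, hb, rfl⟩ := Finset.mem_map.1 hi
  simpa using Tuple.monotone_sort f (Finset.mem_Iic.1 hb)

theorem integral_gaussNorm_far_le {p pstar q qstar : ℝ≥0∞} (hp : ExponentLow p)
    (hq : ExponentLow qstar) (hps : pstar ≠ ⊤) (hps0 : 0 < pstar.toReal)
    (hqs : q ≠ ⊤) (hqs0 : 0 < q.toReal) {β1 β2 β3 e : ℝ} (h1 : 0 ≤ β1) (h2 : 0 ≤ β2)
    (h3 : 0 ≤ β3) (he0 : 0 ≤ e) (he1 : e ≤ 1) {m n : ℕ} (hm : 0 < m) (hn : 0 < n)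
    (H : ∀ A : Fin m → Fin n → ℝ, EopNorm p qstar A ≤ β1 * D1 pstar A + β2 * D2 q A +
      β3 * ⨆ ij : Fin m × Fin n, ((ij.1.1 + ij.2.1 + 2 : ℕ) : ℝ) ^ e * |A ij.1 ij.2|)
    (A : Fin m → Fin n → ℝ) {d1 d2 D : ℝ}
    (hd1 : ∀ i, _root_.lpNorm pstar (fun j => A i j) ≤ d1)
    (hd2 : ∀ j, _root_.lpNorm q (fun i => A i j) ≤ d2) (f : Fin m → ℕ) (h : Fin n → ℕ)
    (hf : ∀ l, (Finset.univ.filter fun i => f i ≤ l).card ≤ 2 ^ (8 * 2 ^ l))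
    (hh : ∀ l, (Finset.univ.filter fun j => h j ≤ l).card ≤ 2 ^ (8 * 2 ^ l))
    (hA : ∀ i j, (2 ^ (8 * 2 ^ max (f i) (h j)) : ℝ) ^ e * |A i j| ≤ D) :
    ∫ g, gaussNorm p qstar A g ∂_root_.stdGaussian (Fin m × Fin n) ≤
      β1 * d1 + β2 * d2 + β3 * (2 * D) := by
  obtain ⟨σ, hσ⟩ := exists_sorting f
  obtain ⟨τ, hτ⟩ := exists_sorting h
  have : Nonempty (Fin m) := ⟨⟨0, hm⟩⟩
  have : Nonempty (Fin n) := ⟨⟨0, hn⟩⟩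
  set B : Fin m → Fin n → ℝ := fun i j => A (σ i) (τ j) with hB
  have hle := integral_gaussNorm_comp_le hp hq σ.symm.injective τ.symm.injective B
  simp only [hB, Equiv.apply_symm_apply] at hle
  refine hle.trans ((H B).trans ?_)
  gcongr
  · exact ciSup_le fun i => (lpNorm_comp_le hps hps0 τ.injective (A (σ i))).trans (hd1 _)
  · exact ciSup_le fun j =>
      (lpNorm_comp_le hqs hqs0 σ.injective (fun i => A i (τ j))).trans (hd2 _)
  · refine ciSup_le fun x => ?_
    obtain ⟨a, b⟩ := x
    set L := max (f (σ a)) (h (τ b)) with hL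
    have hpow : ∀ l, l ≤ L → 2 ^ (8 * 2 ^ l) ≤ 2 ^ (8 * 2 ^ L) := fun l hl =>
      Nat.pow_le_pow_right (by norm_num)
        (Nat.mul_le_mul_left _ (Nat.pow_le_pow_right (by norm_num) hl))
    have hidx : a.val + b.val + 2 ≤ 2 * 2 ^ (8 * 2 ^ L) := by
      have ha := ((hσ a).trans (hf _)).trans (hpow _ (le_max_left _ _))
      have hb := ((hτ b).trans (hh _)).trans (hpow _ (le_max_right _ _))
      omega
    have hidx' : ((a.val + b.val + 2 : ℕ) : ℝ) ≤ 2 * 2 ^ (8 * 2 ^ L) := by exact_mod_cast hidx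
    calc ((a.val + b.val + 2 : ℕ) : ℝ) ^ e * |A (σ a) (τ b)|
        ≤ (2 * 2 ^ (8 * 2 ^ L)) ^ e * |A (σ a) (τ b)| := by
          gcongr
      _ = 2 ^ e * ((2 ^ (8 * 2 ^ L)) ^ e * |A (σ a) (τ b)|) := by
          rw [Real.mul_rpow (by norm_num) (by positivity), mul_assoc]
      _ ≤ 2 ^ (1 : ℝ) * ((2 ^ (8 * 2 ^ L)) ^ e * |A (σ a) (τ b)|) := by
          gcongr
          norm_num
      _ = 2 * ((2 ^ (8 * 2 ^ L)) ^ e * |A (σ a) (τ b)|) := by rw [Real.rpow_one]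
      _ ≤ 2 * D := by
          gcongr
          exact hA (σ a) (τ b)

/-! ### Conjugate exponents and the main theorem -/

theorem ExponentLow.of_conjugate {r s : ℝ≥0∞} (h : 1 / r + 1 / s = 1) (hs : 2 ≤ s) :
    ExponentLow r := by
  simp only [one_div] at h
  have h1 : 1 ≤ r := by
    rw [← ENNReal.inv_le_one]
    exact le_self_add.trans h.le
  have h2 : r ≤ 2 := by
    by_contra hcon
    have hlt : r⁻¹ + s⁻¹ < 2⁻¹ + 2⁻¹ :=
      ENNReal.add_lt_add_of_lt_of_le (by simpa using (zero_lt_two.trans_le hs).ne')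
        (ENNReal.inv_lt_inv.2 (not_le.1 hcon)) (ENNReal.inv_le_inv.2 hs)
    rw [h, ENNReal.inv_two_add_inv_two] at hlt
    exact lt_irrefl _ hlt
  have hr : r ≠ ⊤ := ne_top_of_le_ne_top (by simp) h2
  exact ⟨hr, by simpa using ENNReal.toReal_mono hr h1, by simpa using ENNReal.toReal_mono (by simp) h2⟩

theorem lpNorm_nonneg_of_fintype (r : ℝ≥0∞) {ι : Type*} [Fintype ι] (x : ι → ℝ) :
    0 ≤ _root_.lpNorm r x := by
  by_cases hr : r = ⊤
  · unfold _root_.lpNorm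
    rw [if_pos hr]
    exact Real.iSup_nonneg fun _ => abs_nonneg _
  · exact lpNorm_nonneg' hr x

theorem abs_le_lpNorm_top {ι : Type*} [Fintype ι] (x : ι → ℝ) (i : ι) :
    |x i| ≤ _root_.lpNorm ⊤ x := by
  unfold _root_.lpNorm
  rw [if_pos rfl]
  exact le_ciSup (f := fun i => |x i|) (Set.finite_range _).bddAbove i

theorem lpNorm_le_D1 (r : ℝ≥0∞) {m n : ℕ} (A : Fin m → Fin n → ℝ) (i : Fin m) :
    _root_.lpNorm r (fun j => A i j) ≤ D1 r A :=
  le_ciSup (f := fun i => _root_.lpNorm r fun j => A i j) (Set.finite_range _).bddAbove i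

theorem lpNorm_le_D2 (r : ℝ≥0∞) {m n : ℕ} (A : Fin m → Fin n → ℝ) (j : Fin n) :
    _root_.lpNorm r (fun i => A i j) ≤ D2 r A :=
  le_ciSup (f := fun j => _root_.lpNorm r fun i => A i j) (Set.finite_range _).bddAbove j

theorem lpNorm_mono {r : ℝ≥0∞} (hr : r ≠ ⊤) (h0 : 0 < r.toReal) {ι : Type*} [Fintype ι]
    {x y : ι → ℝ} (h : ∀ i, |x i| ≤ |y i|) : _root_.lpNorm r x ≤ _root_.lpNorm r y := by
  rw [lpNorm_le_iff hr h0 _ (lpNorm_nonneg' hr y), lpNorm_rpow hr h0]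
  exact Finset.sum_le_sum fun i _ => Real.rpow_le_rpow (abs_nonneg _) (h i) h0.le

theorem card_subtype_le_of_filter {m : ℕ} {f f' : Fin m → ℕ} (hff' : ∀ i, f' i ≤ f i)
    (hf' : ∀ l, (Finset.univ.filter fun i => f' i ≤ l).card ≤ 2 ^ (8 * 2 ^ l)) (l : ℕ) :
    Fintype.card {i // f i = l} ≤ 2 ^ (8 * 2 ^ l) := by
  rw [Fintype.card_subtype]
  refine le_trans (Finset.card_le_card fun i hi => ?_) (hf' l)
  simp only [Finset.mem_filter, Finset.mem_univ, true_and] at hi ⊢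
  exact hi ▸ hff' i

theorem exponent_bounds {r s : ℝ≥0∞} (hr : r ≠ ⊤) (hs : s ≠ ⊤) (h : 2 ≤ r) :
    0 ≤ (1 / (8 * max r s)).toReal ∧ (1 / (8 * max r s)).toReal ≤ 1 ∧
      (1 / (8 * max r s)).toReal * r.toReal ≤ 1 / 8 ∧
      (1 / (8 * max r s)).toReal * s.toReal ≤ 1 / 8 := by
  have hm : max r s ≠ ⊤ := by simp [hr, hs]
  have hR : (1 / (8 * max r s)).toReal = 1 / (8 * (max r s).toReal) := by
    simp [ENNReal.toReal_inv, ENNReal.toReal_mul]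
  have h1 : r.toReal ≤ (max r s).toReal := ENNReal.toReal_mono hm (le_max_left _ _)
  have h2 : s.toReal ≤ (max r s).toReal := ENNReal.toReal_mono hm (le_max_right _ _)
  have h3 : 2 ≤ r.toReal := by simpa using ENNReal.toReal_mono hr h
  rw [hR]
  set R := (max r s).toReal
  have hRpos : 0 < R := by linarith
  refine ⟨by positivity, ?_, ?_, ?_⟩
  · rw [div_le_one (by positivity)]
    linarith
  · rw [div_mul_eq_mul_div, div_le_div_iff₀ (by positivity) (by norm_num)]
    linarith
  · rw [div_mul_eq_mul_div, div_le_div_iff₀ (by positivity) (by norm_num)]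
    linarith

/-- The restriction of a matrix to the entries satisfying `P`. -/
def maskMatrix {ι κ : Type*} (P : ι → κ → Prop) [∀ i j, Decidable (P i j)] (A : ι → κ → ℝ) :
    ι → κ → ℝ := fun i j => if P i j then A i j else 0

theorem abs_maskMatrix_le {ι κ : Type*} (P : ι → κ → Prop) [∀ i j, Decidable (P i j)]
    (A : ι → κ → ℝ) (i : ι) (j : κ) : |maskMatrix P A i j| ≤ |A i j| := by
  unfold maskMatrix
  split_ifs
  · exact le_rfl
  · simp

theorem combined_estimate {p pstar q qstar : ℝ≥0∞} (hp : ExponentLow p)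
    (hq : ExponentLow qstar) (hps : pstar ≠ ⊤) (hqs : q ≠ ⊤) (hps2 : 2 ≤ pstar) (hqs2 : 2 ≤ q)
    {α1 α2 α3 β1 β2 β3 : ℝ} (hα1 : 0 ≤ α1) (hα2 : 0 ≤ α2) (hα3 : 0 ≤ α3) (hβ1 : 0 ≤ β1)
    (hβ2 : 0 ≤ β2) (hβ3 : 0 ≤ β3) (H1 : LogEstimate p pstar q qstar α1 α2 α3) {m n : ℕ}
    (hm : 0 < m) (hn : 0 < n)
    (H2 : ∀ A : Fin m → Fin n → ℝ, EopNorm p qstar A ≤ β1 * D1 pstar A + β2 * D2 q A +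
      β3 * ⨆ ij : Fin m × Fin n,
        ((ij.1.1 + ij.2.1 + 2 : ℕ) : ℝ) ^ (1 / (8 * max pstar q)).toReal * |A ij.1 ij.2|)
    (A : Fin m → Fin n → ℝ) :
    EopNorm p qstar A ≤ 3 * (6 * (α1 * D1 pstar A + α2 * D2 q A + 5 * α3 * (2 * Dinf A))) +
      (β1 * D1 pstar A + β2 * D2 q A + β3 * (2 * max (D1 pstar A) (D2 q A))) := by
  have hps0 : 0 < pstar.toReal := ENNReal.toReal_pos (zero_lt_two.trans_le hps2).ne' hps
  have hqs0 : 0 < q.toReal := ENNReal.toReal_pos (zero_lt_two.trans_le hqs2).ne' hqs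
  obtain ⟨he0, he1, hep, heq⟩ := exponent_bounds hps hqs hps2
  set e := (1 / (8 * max pstar q)).toReal
  set d1 := D1 pstar A
  set d2 := D2 q A
  have hd1 := lpNorm_le_D1 pstar A
  have hd2 := lpNorm_le_D2 q A
  have hd1n : 0 ≤ d1 := (lpNorm_nonneg_of_fintype _ _).trans (hd1 ⟨0, hm⟩)
  have hd2n : 0 ≤ d2 := (lpNorm_nonneg_of_fintype _ _).trans (hd2 ⟨0, hn⟩)
  have hDn : 0 ≤ Dinf A := (abs_nonneg _).trans (abs_le_Dinf A ⟨0, hm⟩ ⟨0, hn⟩)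
  obtain ⟨f, h, hf, hh, hfA, hhA, hfar, hfar'⟩ := exists_matrix_levels A hps hps0 hqs hqs0
    (D := max d1 d2) hep heq (fun i => (hd1 i).trans (le_max_left _ _))
    (fun j => (hd2 j).trans (le_max_right _ _))
  have hmask1 : ∀ (P : Fin m → Fin n → Prop) [∀ i j, Decidable (P i j)] (i : Fin m),
      _root_.lpNorm pstar (fun j => maskMatrix P A i j) ≤ d1 := fun P _ i =>
    (lpNorm_mono hps hps0 fun j => abs_maskMatrix_le P A i j).trans (hd1 i)
  have hmask2 : ∀ (P : Fin m → Fin n → Prop) [∀ i j, Decidable (P i j)] (j : Fin n),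
      _root_.lpNorm q (fun i => maskMatrix P A i j) ≤ d2 := fun P _ j =>
    (lpNorm_mono hqs hqs0 fun i => abs_maskMatrix_le P A i j).trans (hd2 j)
  have hnear : ∀ (f' : Fin m → ℕ) (h' : Fin n → ℕ), (∀ i, f i ≤ f' i) → (∀ j, h j ≤ h' j) →
      (∀ i j, f' i = h' j → f i = f' i ∨ h j = f' i) →
      ∫ g, gaussNorm p qstar (maskMatrix (fun i j => f' i = h' j) A) g
        ∂_root_.stdGaussian (Fin m × Fin n) ≤
        6 * (α1 * d1 + α2 * d2 + 5 * α3 * (2 * Dinf A)) := by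
    intro f' h' hff' hhh' hlev
    refine H1.integral_block_le hp hq hps hps0 hqs hqs0 hα1 hα2 hα3 _ hd1n hd2n
      (by positivity) (hmask1 _) (hmask2 _) f' h' (card_subtype_le_of_filter hff' hf)
      (card_subtype_le_of_filter hhh' hh) (fun i j hij => if_neg hij) fun i j hij => ?_
    refine (mul_le_mul_of_nonneg_right (abs_maskMatrix_le _ A i j) (Real.sqrt_nonneg _)).trans ?_
    rcases hlev i j hij with hl | hl
    · rw [← hl]
      exact hfA i j
    · rw [← hl]
      exact hhA i j
  have h0 := hnear f h (fun _ => le_rfl) (fun _ => le_rfl) fun _ _ _ => Or.inl rfl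
  have hR := hnear f (fun j => h j + 1) (fun _ => le_rfl) (fun _ => Nat.le_succ _)
    fun _ _ _ => Or.inl rfl
  have hL := hnear (fun i => f i + 1) h (fun _ => Nat.le_succ _) (fun _ => le_rfl)
    fun _ _ hij => Or.inr hij.symm
  have hF := integral_gaussNorm_far_le hp hq hps hps0 hqs hqs0 hβ1 hβ2 hβ3 he0 he1 hm hn H2
    (maskMatrix (fun i j => h j + 2 ≤ f i ∨ f i + 2 ≤ h j) A) (hmask1 _) (hmask2 _) f h hf hh
    (D := max d1 d2) (fun i j => by
      unfold maskMatrix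
      split_ifs with hij
      · rcases hij with hij | hij
        · rw [max_eq_left (by omega)]
          exact hfar i j hij
        · rw [max_eq_right (by omega)]
          exact hfar' i j hij
      · rw [abs_zero, mul_zero]
        exact hd1n.trans (le_max_left _ _))
  set A0 := maskMatrix (fun i j => f i = h j) A with hA0
  set AR := maskMatrix (fun i j => f i = h j + 1) A with hAR
  set AL := maskMatrix (fun i j => f i + 1 = h j) A with hAL
  set AF := maskMatrix (fun i j => h j + 2 ≤ f i ∨ f i + 2 ≤ h j) A with hAF
  have hsum : A = fun i j => A0 i j + (AR i j + (AL i j + AF i j)) := by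
    funext i j
    simp only [hA0, hAR, hAL, hAF, maskMatrix]
    rcases lt_trichotomy (f i) (h j) with hlt | heq' | hgt
    · rcases Nat.lt_or_ge (f i + 1) (h j) with h' | h'
      · rw [if_neg (by omega), if_neg (by omega), if_neg (by omega), if_pos (by omega)]
        ring
      · rw [if_neg (by omega), if_neg (by omega), if_pos (by omega), if_neg (by omega)]
        ring
    · rw [if_pos heq', if_neg (by omega), if_neg (by omega), if_neg (by omega)]
      ring
    · rcases Nat.lt_or_ge (h j + 1) (f i) with h' | h'
      · rw [if_neg (by omega), if_neg (by omega), if_neg (by omega), if_pos (by omega)]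
        ring
      · rw [if_neg (by omega), if_pos (by omega), if_neg (by omega), if_neg (by omega)]
        ring
  have s1 := integral_gaussNorm_add_le hp hq A0 (fun i j => AR i j + (AL i j + AF i j))
  have s2 := integral_gaussNorm_add_le hp hq AR (fun i j => AL i j + AF i j)
  have s3 := integral_gaussNorm_add_le hp hq AL AF
  rw [← hsum] at s1
  change ∫ g, gaussNorm p qstar A g ∂_root_.stdGaussian (Fin m × Fin n) ≤ _
  linarith

/-- Proposition: the two weaker estimates suffice:
if for all matrices `E‖G_A‖ ≤ α1 D1 + α2 D2 + α3 √(Log(mn)) max|a_{ij}|` and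
`E‖G_A‖ ≤ β1 D1 + β2 D2 + β3 max (i+j)^{1/(8(p*∨q))}|a_{ij}|`, then for all matrices
`E‖G_A‖ ≤ C((α1+β1+β3) D1 + (α2+β2+β3) D2 + α3 Dinf)` with a universal `C`. -/
theorem prop_weaker_estimates_suffice :
    ∃ C : ℝ, 0 < C ∧
      ∀ p pstar q qstar : ℝ≥0∞,
        1 / p + 1 / pstar = 1 → 1 / q + 1 / qstar = 1 →
        2 ≤ pstar → 2 ≤ q →
        ∀ α1 α2 α3 β1 β2 β3 : ℝ,
          1 ≤ α1 → 1 ≤ α2 → 1 ≤ α3 → 1 ≤ β1 → 1 ≤ β2 → 1 ≤ β3 →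
          (∀ (m n : ℕ), 0 < m → 0 < n → ∀ A : Fin m → Fin n → ℝ,
            EopNorm p qstar A ≤
              α1 * D1 pstar A + α2 * D2 q A +
                α3 * Real.sqrt (Log ((m : ℝ) * (n : ℝ))) * maxEntry A) →
          (∀ (m n : ℕ), 0 < m → 0 < n → ∀ A : Fin m → Fin n → ℝ,
            EopNorm p qstar A ≤
              β1 * D1 pstar A + β2 * D2 q A +
                β3 * ⨆ ij : Fin m × Fin n,
                  ((ij.1.1 + ij.2.1 + 2 : ℕ) : ℝ) ^ (1 / (8 * max pstar q)).toReal *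
                    |A ij.1 ij.2|) →
          ∀ (m n : ℕ), 0 < m → 0 < n → ∀ A : Fin m → Fin n → ℝ,
            EopNorm p qstar A ≤
              C * ((α1 + β1 + β3) * D1 pstar A + (α2 + β2 + β3) * D2 q A +
                α3 * Dinf A) := by
  refine ⟨180, by norm_num, ?_⟩
  intro p pstar q qstar hpp hqq hps2 hqs2 α1 α2 α3 β1 β2 β3 hα1 hα2 hα3 hβ1 hβ2 hβ3 H1 H2
    m n hm hn A
  have hd1 := lpNorm_le_D1 pstar A
  have hd2 := lpNorm_le_D2 q A
  have hd1n : 0 ≤ D1 pstar A := (lpNorm_nonneg_of_fintype _ _).trans (hd1 ⟨0, hm⟩)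
  have hd2n : 0 ≤ D2 q A := (lpNorm_nonneg_of_fintype _ _).trans (hd2 ⟨0, hn⟩)
  have hDn : 0 ≤ Dinf A := (abs_nonneg _).trans (abs_le_Dinf A ⟨0, hm⟩ ⟨0, hn⟩)
  have a1 := mul_nonneg (zero_le_one.trans hα1) hd1n
  have a2 := mul_nonneg (zero_le_one.trans hα2) hd2n
  have a3 := mul_nonneg (zero_le_one.trans hα3) hDn
  have b1 := mul_nonneg (zero_le_one.trans hβ1) hd1n
  have b2 := mul_nonneg (zero_le_one.trans hβ2) hd2n
  have b3 := mul_nonneg (zero_le_one.trans hβ3) hd1n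
  have b4 := mul_nonneg (zero_le_one.trans hβ3) hd2n
  by_cases htop : pstar = ⊤ ∨ q = ⊤
  · have : Nonempty (Fin m × Fin n) := ⟨(⟨0, hm⟩, ⟨0, hn⟩)⟩
    have hmax : max pstar q = ⊤ := by rcases htop with h | h <;> simp [h]
    have hent : ∀ i j, |A i j| ≤ D1 pstar A + D2 q A := by
      intro i j
      rcases htop with rfl | rfl
      · linarith [(abs_le_lpNorm_top (A i) j).trans (hd1 i)]
      · linarith [(abs_le_lpNorm_top (fun i => A i j) i).trans (hd2 j)]
    have h := H2 m n hm hn A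
    have hsup : (⨆ ij : Fin m × Fin n, ((ij.1.1 + ij.2.1 + 2 : ℕ) : ℝ) ^
        (1 / (8 * max pstar q)).toReal * |A ij.1 ij.2|) ≤ D1 pstar A + D2 q A := by
      refine ciSup_le fun x => ?_
      rw [hmax, ENNReal.mul_top (by norm_num), one_div, ENNReal.inv_top, ENNReal.toReal_zero,
        Real.rpow_zero, one_mul]
      exact hent _ _
    have := mul_le_mul_of_nonneg_left hsup (zero_le_one.trans hβ3)
    linarith
  · rw [not_or] at htop
    have h := combined_estimate (ExponentLow.of_conjugate hpp hps2)
      (ExponentLow.of_conjugate (by rwa [add_comm]) hqs2) htop.1 htop.2 hps2 hqs2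
      (zero_le_one.trans hα1) (zero_le_one.trans hα2) (zero_le_one.trans hα3)
      (zero_le_one.trans hβ1) (zero_le_one.trans hβ2) (zero_le_one.trans hβ3) H1 hm hn
      (H2 m n hm hn) A
    have hmax : max (D1 pstar A) (D2 q A) ≤ D1 pstar A + D2 q A :=
      max_le (by linarith) (by linarith)
    have := mul_le_mul_of_nonneg_left hmax (zero_le_one.trans hβ3)
    linarith
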